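/- arXiv:2305.03543 — 2 statements merged into one kernel-verified Lean document; each statement's English description precedes it below -/
import Mathlib

section
/- Fix c > 0 and a positive integer k. There exist C = C(c,k) > 0 and n_0 such that the following holds for all n ≥ n_0, all γ ∈ [−1,1] with γ√n ∈ ℤ, and every pair of partitions [2n] = A_1 ∪ A_2 = B_1 ∪ B_2 with |A_1| = |A_2| = |B_1| = |B_2| = n and c·n ≤ |A_1 ∩ B_1| ≤ (1−c)·n: for G ∼ G(2n,1/2), call a vertex v critical for A if v ∈ A_i and deg(v, A_i) = deg(v, A_{i+1}) + γ√n (indices mod 2), and let X be the number of vertices critical for A. Then E[X^k | E_1] ≤ C·n^{k/2} and E[X^k | E_2] ≤ C·n^{k/2}. -/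
/-- The probability, under the uniform measure on labeled graphs on `Fin n`
(equivalently under `G(n,1/2)`), of a graph property `P`. -/
noncomputable def graphProb (n : ℕ) (P : SimpleGraph (Fin n) → Prop) : ℝ :=
  (Nat.card {G : SimpleGraph (Fin n) // P G} : ℝ) / 2 ^ n.choose 2

/-- `deg(v,S)`: the number of neighbors of `v` inside the vertex set `S`. -/
noncomputable def degIn {n : ℕ} (G : SimpleGraph (Fin n)) (v : Fin n)
    (S : Finset (Fin n)) : ℕ :=
  Nat.card {w : Fin n // w ∈ S ∧ G.Adj v w}

/-- The friendliness event for the partition `A ∪ Aᶜ` with margin `t`: every vertex has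
at least `t` more neighbours in its own part than in the other part. -/
def FriendlyPair {m : ℕ} (G : SimpleGraph (Fin m)) (A : Finset (Fin m)) (t : ℝ) : Prop :=
  (∀ v ∈ A, (degIn G v Aᶜ : ℝ) + t ≤ (degIn G v A : ℝ)) ∧
  (∀ v ∈ (Aᶜ : Finset (Fin m)), (degIn G v A : ℝ) + t ≤ (degIn G v Aᶜ : ℝ))

/-- The number of vertices critical for the partition `A ∪ Aᶜ`: vertices whose degree into
their own part exactly equals their degree into the other part plus `t`. -/
noncomputable def critCount {m : ℕ} (G : SimpleGraph (Fin m)) (A : Finset (Fin m))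
    (t : ℝ) : ℕ :=
  Nat.card {v : Fin m //
    (v ∈ A ∧ (degIn G v A : ℝ) = (degIn G v Aᶜ : ℝ) + t) ∨
    (v ∈ (Aᶜ : Finset (Fin m)) ∧ (degIn G v Aᶜ : ℝ) = (degIn G v A : ℝ) + t)}

/-- `E[Z · 1_E]` for a graph functional `Z` and event `E`, under `G ∼ G(m,1/2)`. -/
noncomputable def graphCondExp (m : ℕ) (E : SimpleGraph (Fin m) → Prop)
    (Z : SimpleGraph (Fin m) → ℝ) : ℝ :=
  (∑ G : SimpleGraph (Fin m), Set.indicator {G | E G} Z G) / 2 ^ m.choose 2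

section

open Finset

open scoped Classical in
/-- The number of elements of a finite type satisfying a predicate, as a real number. -/
noncomputable def countWhere {β : Type*} [Fintype β] (q : β → Prop) : ℝ :=
  #{x : β | q x}

lemma countWhere_eq {β : Type*} [Fintype β] (q : β → Prop) [DecidablePred q] :
    countWhere q = #{x : β | q x} := by
  unfold countWhere
  congr

lemma countWhere_nonneg {β : Type*} [Fintype β] (q : β → Prop) : 0 ≤ countWhere q :=
  Nat.cast_nonneg _

lemma countWhere_mono {β : Type*} [Fintype β] {q q' : β → Prop} (h : ∀ x, q x → q' x) :
    countWhere q ≤ countWhere q' := by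
  classical
  rw [countWhere_eq, countWhere_eq]
  exact_mod_cast card_le_card (monotone_filter_right _ fun x _ => h x)

lemma countWhere_eq_sum_indicator {β : Type*} [Fintype β] (q : β → Prop) :
    countWhere q = ∑ x, Set.indicator {x | q x} (fun _ => (1 : ℝ)) x := by
  classical
  rw [countWhere_eq]
  simp [Set.indicator_apply]

open scoped Classical in
/-- One step of the switching argument: if `Q` is preserved by inserting elements of `P`, the
number of sets satisfying `Q` and meeting `P` in `m + 1` points is controlled from below by the
number of those meeting `P` in `m` points. -/
lemma card_level_mul_le {α : Type*} [Fintype α] [DecidableEq α] (P : Finset α) (Q : Finset α → Prop)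
    (hQ : ∀ ω : Finset α, ∀ e ∈ P, e ∉ ω → Q ω → Q (insert e ω)) (m : ℕ) :
    #{ω : Finset α | Q ω ∧ #(ω ∩ P) = m} * (#P - m) ≤
      #{ω : Finset α | Q ω ∧ #(ω ∩ P) = m + 1} * (m + 1) := by
  apply card_mul_le_card_mul (fun ω ω' : Finset α => ∃ e ∈ P, e ∉ ω ∧ ω' = insert e ω)
  · intro ω hω
    simp only [mem_filter, mem_univ, true_and] at hω
    have hsub : (P \ ω).image (fun e => insert e ω) ⊆
        bipartiteAbove (fun ω ω' : Finset α => ∃ e ∈ P, e ∉ ω ∧ ω' = insert e ω)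
          {ω : Finset α | Q ω ∧ #(ω ∩ P) = m + 1} ω := by
      intro ω' hω'
      obtain ⟨e, he, rfl⟩ := mem_image.1 hω'
      rw [mem_sdiff] at he
      simp only [mem_bipartiteAbove, mem_filter, mem_univ, true_and]
      refine ⟨⟨hQ ω e he.1 he.2 hω.1, ?_⟩, e, he.1, he.2, rfl⟩
      rw [insert_inter_of_mem he.1, card_insert_of_notMem (by simp [he.2]), hω.2]
    refine le_trans (le_of_eq ?_) (card_le_card hsub)
    rw [card_image_of_injOn, card_sdiff, hω.2]
    intro e he f hf hef
    have he' := (mem_sdiff.1 (mem_coe.1 he)).2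
    have : e ∈ insert f ω := by
      have h : insert e ω = insert f ω := hef
      rw [← h]; exact mem_insert_self _ _
    exact (mem_insert.1 this).resolve_right he'
  · intro ω' hω'
    simp only [mem_filter, mem_univ, true_and] at hω'
    rw [← hω'.2]
    refine le_trans (card_le_card (t := (ω' ∩ P).image fun e => ω'.erase e) ?_) card_image_le
    intro ω hω
    simp only [mem_bipartiteBelow, mem_filter, mem_univ, true_and] at hω
    obtain ⟨-, e, heP, he, rfl⟩ := hω
    exact mem_image.2 ⟨e, by simp [heP], erase_insert he⟩

open scoped Classical in
/-- Hazard bound: if `Q` is preserved by inserting elements of `P`, only a small proportion of the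
sets satisfying `Q` meet `P` in exactly `m` points. -/
lemma card_level_mul_card_le {α : Type*} [Fintype α] [DecidableEq α] (P : Finset α)
    (Q : Finset α → Prop) (hQ : ∀ ω : Finset α, ∀ e ∈ P, e ∉ ω → Q ω → Q (insert e ω)) (m : ℝ) :
    countWhere (fun ω : Finset α => Q ω ∧ (#(ω ∩ P) : ℝ) = m) * #P ≤
      24 * (√(#P : ℝ) + |2 * m - (#P : ℝ)|) * countWhere Q := by
  simp only [countWhere_eq]
  set D : ℝ := √(#P : ℝ) + |2 * m - (#P : ℝ)| with hD
  have hD0 : 0 ≤ D := by positivity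
  by_cases hm : ∃ k : ℕ, (k : ℝ) = m
  swap
  · have : ({ω : Finset α | Q ω ∧ (#(ω ∩ P) : ℝ) = m} : Finset (Finset α)) = ∅ := by
      apply filter_eq_empty_iff.2
      rintro ω - ⟨-, h⟩
      exact hm ⟨_, h⟩
    rw [this]
    simp only [card_empty, Nat.cast_zero, zero_mul]
    positivity
  obtain ⟨m, rfl⟩ := hm
  set L : ℕ → ℝ := fun j => (#{ω : Finset α | Q ω ∧ #(ω ∩ P) = m + j} : ℝ) with hL
  have hL0 : (#{ω : Finset α | Q ω ∧ (#(ω ∩ P) : ℝ) = m} : ℝ) = L 0 := by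
    simp [hL]
  rw [hL0]
  have hLnn : ∀ j, 0 ≤ L j := fun j => by positivity
  by_cases hbig : (#P : ℝ) ≤ 24 * D
  · have h1 : L 0 ≤ #{ω : Finset α | Q ω} := by
      simp only [hL]
      exact_mod_cast card_le_card (fun ω hω => by simp at hω ⊢; exact hω.1)
    calc L 0 * #P ≤ #{ω : Finset α | Q ω} * (24 * D) := by gcongr
      _ = _ := by ring
  push Not at hbig
  set p : ℝ := (#P : ℝ) with hp
  have hp0 : 0 < p := by linarith
  have hsq : 0 < √p := Real.sqrt_pos.2 hp0
  have hDs : √p ≤ D := by rw [hD]; linarith [abs_nonneg (2 * (m : ℝ) - p)]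
  have hDpos : 0 < D := by linarith
  have hmD : 2 * (m : ℝ) - p ≤ D := by rw [hD]; linarith [le_abs_self (2 * (m : ℝ) - p)]
  set J := ⌊p / (12 * D)⌋₊ with hJ
  have hJle : (J : ℝ) ≤ p / (12 * D) := Nat.floor_le (by positivity)
  have hJD : (J : ℝ) ≤ D := by
    refine hJle.trans ?_
    rw [div_le_iff₀ (by positivity)]
    nlinarith [Real.mul_self_sqrt hp0.le]
  set ρ : ℝ := 1 - 6 * D / p with hρ
  have hDp : 6 * D / p ≤ 1 := by rw [div_le_one hp0]; linarith
  have hρ0 : 0 ≤ ρ := by rw [hρ]; linarith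
  have hstep : ∀ j, j + 1 ≤ J → ρ * L j ≤ L (j + 1) := by
    intro j hj
    have hj' : (j : ℝ) + 1 ≤ D := le_trans (by exact_mod_cast hj) hJD
    have h := card_level_mul_le P Q hQ (m + j)
    have hmj : m + j ≤ #P := by
      have : ((m + j : ℕ) : ℝ) ≤ #P := by push_cast; linarith
      exact_mod_cast this
    have h' : L j * (p - (m + j)) ≤ L (j + 1) * (m + j + 1) := by
      have h2 : ((#{ω : Finset α | Q ω ∧ #(ω ∩ P) = m + j} * (#P - (m + j)) : ℕ) : ℝ) ≤
        ((#{ω : Finset α | Q ω ∧ #(ω ∩ P) = m + j + 1} * (m + j + 1) : ℕ) : ℝ) := by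
        exact_mod_cast h
      push_cast [Nat.cast_sub hmj] at h2
      exact h2
    have h3 : ρ * ((m : ℝ) + j + 1) ≤ p - (m + j) := by
      have hM : (m : ℝ) + j + 1 ≤ p / 2 + 3 / 2 * D := by linarith
      have hu : 0 ≤ 2 - 6 * D / p := by linarith
      have h4 : (2 - 6 * D / p) * ((m : ℝ) + j + 1) ≤ (2 - 6 * D / p) * (p / 2 + 3 / 2 * D) := by
        gcongr
      have h5 : (2 - 6 * D / p) * (p / 2 + 3 / 2 * D) = p - 9 * D ^ 2 / p := by
        field_simp; ring
      have h6 : 0 ≤ 9 * D ^ 2 / p := by positivity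
      rw [hρ]
      nlinarith
    have hpos : (0 : ℝ) < m + j + 1 := by positivity
    refine le_of_mul_le_mul_right ?_ hpos
    calc ρ * L j * (m + j + 1) = L j * (ρ * (m + j + 1)) := by ring
      _ ≤ L j * (p - (m + j)) := by gcongr
      _ ≤ _ := h'
  have hpow : ∀ j ≤ J, ρ ^ j * L 0 ≤ L j := by
    intro j
    induction j with
    | zero => simp
    | succ j ih =>
      intro hj
      calc ρ ^ (j + 1) * L 0 = ρ * (ρ ^ j * L 0) := by ring
        _ ≤ ρ * L j := by gcongr; exact ih (by omega)
        _ ≤ _ := hstep j hj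
  have hhalf : ∀ j ≤ J, L 0 / 2 ≤ L j := by
    intro j hj
    have hb : 1 + (j : ℝ) * (-(6 * D / p)) ≤ (1 + -(6 * D / p)) ^ j :=
      one_add_mul_le_pow (by linarith) j
    have hj2 : (j : ℝ) * (6 * D / p) ≤ 1 / 2 := by
      calc (j : ℝ) * (6 * D / p) ≤ (p / (12 * D)) * (6 * D / p) := by
            gcongr
            exact le_trans (by exact_mod_cast hj) hJle
        _ = 1 / 2 := by field_simp; norm_num
    have : (1 / 2 : ℝ) ≤ ρ ^ j := by
      rw [hρ, sub_eq_add_neg]; linarith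
    calc L 0 / 2 = 1 / 2 * L 0 := by ring
      _ ≤ ρ ^ j * L 0 := by gcongr
      _ ≤ _ := hpow j hj
  have hsum : ∑ j ∈ range (J + 1), L j ≤ #{ω : Finset α | Q ω} := by
    simp only [hL]
    rw [← Nat.cast_sum, ← card_biUnion]
    · norm_cast
      apply card_le_card
      intro ω hω
      simp only [mem_biUnion, mem_filter, mem_univ, true_and] at hω ⊢
      obtain ⟨_, _, h, _⟩ := hω
      exact h
    · intro i _ j _ hij
      rw [Function.onFun, disjoint_filter]
      rintro ω - ⟨-, h1⟩ ⟨-, h2⟩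
      omega
  have hsum' : ((J : ℝ) + 1) * (L 0 / 2) ≤ ∑ j ∈ range (J + 1), L j := by
    calc ((J : ℝ) + 1) * (L 0 / 2) = ∑ j ∈ range (J + 1), L 0 / 2 := by simp
      _ ≤ _ := sum_le_sum fun j hj => hhalf j (by simp at hj; omega)
  have hJ1 : p / (12 * D) ≤ J + 1 := (Nat.lt_floor_add_one _).le
  have hfin : p / (12 * D) * (L 0 / 2) ≤ #{ω : Finset α | Q ω} := by
    refine le_trans ?_ (hsum'.trans hsum)
    gcongr
  calc L 0 * p = 24 * D * (p / (12 * D) * (L 0 / 2)) := by field_simp; ring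
    _ ≤ _ := by gcongr

open scoped Classical in
/-- A version of `card_level_mul_card_le` where `Q` is only preserved by insertion of elements of a
large subset `P'` of `P`. -/
lemma card_level_le_of_subset {α : Type*} [Fintype α] [DecidableEq α] {P P' : Finset α}
    (hP' : P' ⊆ P) (Q : Finset α → Prop) (k : ℕ) (hk : #(P \ P') ≤ k) (hkP : 2 * k ≤ #P)
    (hP : 0 < #P)
    (hQ : ∀ ω : Finset α, ∀ e ∈ P', e ∉ ω → Q ω → Q (insert e ω)) (m : ℝ) :
    countWhere (fun ω : Finset α => Q ω ∧ (#(ω ∩ P) : ℝ) = m) ≤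
      48 * (√(#P : ℝ) + |2 * m - (#P : ℝ)| + 3 * k) / #P * countWhere Q := by
  set R := P \ P' with hR
  have hsplit : ∀ ω : Finset α, #(ω ∩ P) = #(ω ∩ R) + #(ω ∩ P') := by
    intro ω
    rw [← card_union_of_disjoint, ← inter_union_distrib_left, hR, sdiff_union_of_subset hP']
    exact (sdiff_disjoint.mono inter_subset_right inter_subset_right)
  have hcard : (#P : ℝ) = #R + #P' := by
    have := hsplit univ
    simp only [univ_inter] at this
    exact_mod_cast this
  have hRk : (#R : ℝ) ≤ k := by exact_mod_cast hk
  have hkP' : 2 * (k : ℝ) ≤ #P := by exact_mod_cast hkP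
  have hP0 : (0 : ℝ) < #P := by exact_mod_cast hP
  set h : ℝ := 48 * (√(#P : ℝ) + |2 * m - (#P : ℝ)| + 3 * k) / #P with hh
  have hlevel : ∀ r ∈ range (k + 1),
      countWhere (fun ω : Finset α => (Q ω ∧ #(ω ∩ R) = r) ∧ (#(ω ∩ P') : ℝ) = m - r) ≤
        h * countWhere (fun ω : Finset α => Q ω ∧ #(ω ∩ R) = r) := by
    intro r hr
    have hrk : (r : ℝ) ≤ k := by
      have := mem_range.1 hr
      exact_mod_cast Nat.le_of_lt_succ this
    have key := card_level_mul_card_le P' (fun ω => Q ω ∧ #(ω ∩ R) = r) (by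
      rintro ω e he heω ⟨h1, h2⟩
      refine ⟨hQ ω e he heω h1, ?_⟩
      rw [insert_inter_of_notMem, h2]
      simp [hR, he]) (m - r)
    set a : ℝ := countWhere (fun ω : Finset α => (Q ω ∧ #(ω ∩ R) = r) ∧ (#(ω ∩ P') : ℝ) = m - r)
    set b : ℝ := countWhere (fun ω : Finset α => Q ω ∧ #(ω ∩ R) = r)
    have hsq : √(#P' : ℝ) ≤ √(#P : ℝ) := by
      apply Real.sqrt_le_sqrt; rw [hcard]; linarith [Nat.cast_nonneg (α := ℝ) #R]
    have habs : |2 * (m - r) - (#P' : ℝ)| ≤ |2 * m - (#P : ℝ)| + 3 * k := by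
      have : 2 * (m - r) - (#P' : ℝ) = (2 * m - #P) + (#R - 2 * r) := by rw [hcard]; ring
      rw [this]
      refine (abs_add_le _ _).trans ?_
      gcongr
      rw [abs_le]
      constructor <;> linarith [Nat.cast_nonneg (α := ℝ) #R, Nat.cast_nonneg (α := ℝ) r]
    have hhalf : (#P : ℝ) / 2 ≤ #P' := by linarith
    rw [hh, div_mul_eq_mul_div, le_div_iff₀ hP0]
    calc a * #P = 2 * (a * (#P / 2)) := by ring
      _ ≤ 2 * (a * #P') := by
        have : 0 ≤ a := countWhere_nonneg _
        gcongr
      _ ≤ 2 * (24 * (√(#P' : ℝ) + |2 * (m - r) - (#P' : ℝ)|) * b) :=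
        mul_le_mul_of_nonneg_left key (by norm_num)
      _ ≤ 2 * (24 * (√(#P : ℝ) + (|2 * m - (#P : ℝ)| + 3 * k)) * b) := by
        have := countWhere_nonneg (fun ω : Finset α => Q ω ∧ #(ω ∩ R) = r)
        gcongr
      _ = _ := by ring
  have hmaps : ∀ q : Finset α → Prop,
      countWhere q =
        ∑ r ∈ range (k + 1), countWhere (fun ω : Finset α => q ω ∧ #(ω ∩ R) = r) := by
    intro q
    simp only [countWhere_eq]
    rw [card_eq_sum_card_fiberwise (f := fun ω => #(ω ∩ R)) (t := range (k + 1))]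
    · push_cast
      simp only [filter_filter]
    · intro ω _
      have : #(ω ∩ R) ≤ k := (card_le_card inter_subset_right).trans hk
      simp; omega
  rw [hmaps Q, hmaps (fun ω => Q ω ∧ (#(ω ∩ P) : ℝ) = m), mul_sum]
  refine sum_le_sum fun r hr => le_trans (le_of_eq ?_) (hlevel r hr)
  congr 1
  ext ω
  constructor
  · rintro ⟨⟨h1, h2⟩, h3⟩
    refine ⟨⟨h1, h3⟩, ?_⟩
    rw [← h2, hsplit, ← h3]; push_cast; ring
  · rintro ⟨⟨h1, h3⟩, h2⟩
    refine ⟨⟨h1, ?_⟩, h3⟩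
    rw [hsplit, h3]; push_cast; rw [h2]; ring

open scoped Classical in
/-- For an increasing property `Q` and almost disjoint stars `P v`, the events that the stars are
met in prescribed numbers of points are jointly unlikely given `Q`. -/
lemma card_levels_le_prod {α V : Type*} [Fintype α] [DecidableEq α] (P : V → Finset α)
    (hPP : ∀ u v, u ≠ v → #(P u ∩ P v) ≤ 1) (k : ℕ) (hkP : ∀ v, 2 * k ≤ #(P v))
    (hP : ∀ v, 0 < #(P v)) (Q : Finset α → Prop)
    (hQ : ∀ ω : Finset α, ∀ e, Q ω → Q (insert e ω)) (m : V → ℝ) (S : Finset V) (hS : #S ≤ k) :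
    countWhere (fun ω : Finset α => Q ω ∧ ∀ v ∈ S, (#(ω ∩ P v) : ℝ) = m v) ≤
      (∏ v ∈ S, 48 * (√(#(P v) : ℝ) + |2 * m v - (#(P v) : ℝ)| + 3 * k) / #(P v)) *
        countWhere Q := by
  induction S using Finset.induction_on with
  | empty => simp
  | insert v S hv ih =>
    rw [card_insert_of_notMem hv] at hS
    rw [prod_insert hv]
    have h1 := card_level_le_of_subset (P := P v) (P' := P v \ S.biUnion P) sdiff_subset
      (fun ω => Q ω ∧ ∀ u ∈ S, (#(ω ∩ P u) : ℝ) = m u) k (by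
        rw [sdiff_sdiff_right_self, inf_eq_inter, inter_biUnion]
        refine card_biUnion_le.trans ?_
        refine (sum_le_sum fun u hu => hPP v u ?_).trans ?_
        · rintro rfl; exact hv hu
        · simp; omega) (hkP v) (hP v) (by
        rintro ω e he - ⟨hq, hq'⟩
        refine ⟨hQ _ _ hq, fun u hu => ?_⟩
        rw [insert_inter_of_notMem, hq' u hu]
        intro heu
        exact (mem_sdiff.1 he).2 (mem_biUnion.2 ⟨u, hu, heu⟩)) (m v)
    have h2 := ih (by omega)
    refine le_trans (le_of_eq ?_) (h1.trans ?_)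
    · congr 1
      ext ω
      simp only [forall_mem_insert]
      tauto
    · rw [mul_assoc]
      exact mul_le_mul_of_nonneg_left h2 (by positivity)

lemma pow_le_add_descFactorial (x k : ℕ) :
    x ^ k ≤ (2 * k) ^ k + 2 ^ k * x.descFactorial k := by
  rcases le_total x (2 * k) with h | h
  · exact (Nat.pow_le_pow_left h k).trans (Nat.le_add_right _ _)
  · refine le_trans ?_ (Nat.le_add_left _ _)
    calc x ^ k ≤ (2 * (x + 1 - k)) ^ k := Nat.pow_le_pow_left (by omega) k
      _ = 2 ^ k * (x + 1 - k) ^ k := by rw [mul_pow]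
      _ ≤ _ := Nat.mul_le_mul_left _ (Nat.pow_sub_le_descFactorial x k)

open scoped Classical in
lemma descFactorial_card_eq_card_injective {V : Type*} [Fintype V] (s : Finset V) (k : ℕ) :
    (#s).descFactorial k =
      #{f : Fin k → V | Function.Injective f ∧ ∀ i, f i ∈ s} := by
  have h := Fintype.card_embedding_eq (α := Fin k) (β := s)
  rw [Fintype.card_fin, Fintype.card_coe] at h
  rw [← h, ← Fintype.card_subtype]
  refine Fintype.card_congr ⟨fun g => ⟨fun i => g i, ?_, fun i => (g i).2⟩,
    fun f => ⟨fun i => ⟨f.1 i, f.2.2 i⟩, fun i j hij => f.2.1 (congrArg Subtype.val hij)⟩, ?_, ?_⟩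
  · exact fun i j hij => g.injective (Subtype.ext hij)
  · intro g; rfl
  · intro f; rfl

open scoped Classical in
/-- Moment bound for the number of stars met in the prescribed number of points, restricted to an
increasing property. -/
lemma sum_card_critical_pow_le {α V : Type*} [Fintype α] [DecidableEq α] [Fintype V]
    (P : V → Finset α) (hPP : ∀ u v, u ≠ v → #(P u ∩ P v) ≤ 1) (k : ℕ) (hkP : ∀ v, 2 * k ≤ #(P v))
    (hP : ∀ v, 0 < #(P v)) (Q : Finset α → Prop)
    (hQ : ∀ ω : Finset α, ∀ e, Q ω → Q (insert e ω)) (m : V → ℝ) :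
    ∑ ω, Set.indicator {ω : Finset α | Q ω}
        (fun ω => countWhere (fun v : V => (#(ω ∩ P v) : ℝ) = m v) ^ k) ω ≤
      ((2 * k) ^ k + 2 ^ k * (∑ v,
        48 * (√(#(P v) : ℝ) + |2 * m v - (#(P v) : ℝ)| + 3 * k) / #(P v)) ^ k) *
        countWhere Q := by
  simp only [Set.indicator_apply, Set.mem_ofPred_eq, ← sum_filter, countWhere_eq (β := V)]
  set h : V → ℝ := fun v => 48 * (√(#(P v) : ℝ) + |2 * m v - (#(P v) : ℝ)| + 3 * k) / #(P v)
    with hh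
  have hnn : ∀ v, 0 ≤ h v := fun v => by positivity
  set X : Finset α → Finset V := fun ω => {v : V | (#(ω ∩ P v) : ℝ) = m v}
  have hX : ∀ ω v, v ∈ X ω ↔ (#(ω ∩ P v) : ℝ) = m v := fun ω v => by simp [X]
  have h1 : ∑ ω : Finset α with Q ω, (((#(X ω)).descFactorial k : ℕ) : ℝ) ≤
      (∑ v, h v) ^ k * countWhere Q := by
    have e1 : ∀ ω, (((#(X ω)).descFactorial k : ℕ) : ℝ) =
        ∑ f : Fin k → V with Function.Injective f, if ∀ i, f i ∈ X ω then (1 : ℝ) else 0 := by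
      intro ω
      rw [descFactorial_card_eq_card_injective, ← sum_filter, filter_filter]
      simp
    simp_rw [e1]
    rw [sum_comm, Fintype.sum_pow, sum_mul]
    refine le_trans ?_ (sum_le_sum_of_subset_of_nonneg
      (filter_subset (fun f : Fin k → V => Function.Injective f) univ) ?_)
    · refine sum_le_sum fun f hf => ?_
      have hf' : Function.Injective f := (mem_filter.1 hf).2
      have h2 := card_levels_le_prod P hPP k hkP hP Q hQ m (univ.image f)
        (card_image_le.trans (by simp))
      rw [prod_image (fun i _ j _ hij => hf' hij)] at h2
      refine le_trans (le_of_eq ?_) h2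
      rw [← sum_filter, filter_filter, sum_const, nsmul_eq_mul, mul_one, countWhere_eq]
      congr 2
      ext ω
      simp only [mem_filter, mem_univ, true_and, forall_mem_image, true_implies, hX]
    · intro f _ _
      exact mul_nonneg (prod_nonneg fun i _ => hnn _) (countWhere_nonneg _)
  calc ∑ ω : Finset α with Q ω, (#(X ω) : ℝ) ^ k
      ≤ ∑ ω : Finset α with Q ω, ((2 * k : ℝ) ^ k + 2 ^ k * ((#(X ω)).descFactorial k : ℕ)) := by
        refine sum_le_sum fun ω _ => ?_
        exact_mod_cast pow_le_add_descFactorial (#(X ω)) k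
    _ = (2 * k : ℝ) ^ k * countWhere Q +
        2 ^ k * ∑ ω : Finset α with Q ω, (((#(X ω)).descFactorial k : ℕ) : ℝ) := by
        rw [sum_add_distrib, mul_sum, sum_const, nsmul_eq_mul, mul_comm, countWhere_eq]
    _ ≤ (2 * k : ℝ) ^ k * countWhere Q +
        2 ^ k * ((∑ v, h v) ^ k * countWhere Q) := by
        exact add_le_add_right (mul_le_mul_of_nonneg_left h1 (by positivity)) _
    _ = _ := by ring

/-- Twice the deviation of the number of points of `ω` in `R` from half the size of `R`. -/
noncomputable def discrepancy {α : Type*} [DecidableEq α] (ω R : Finset α) : ℝ :=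
  2 * #(ω ∩ R) - #R

lemma discrepancy_mono {α : Type*} [DecidableEq α] {ω ω' : Finset α} (h : ω ⊆ ω') (R : Finset α) :
    discrepancy ω R ≤ discrepancy ω' R := by
  have : (#(ω ∩ R) : ℝ) ≤ #(ω' ∩ R) := by
    exact_mod_cast card_le_card (inter_subset_inter_right h)
  rw [discrepancy, discrepancy]
  linarith

lemma discrepancy_eq_sum {α : Type*} [Fintype α] [DecidableEq α] (ω R : Finset α) :
    discrepancy ω R = ∑ e, (if e ∈ R then 1 else 0) * (if e ∈ ω then (1 : ℝ) else -1) := by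
  simp only [ite_mul, one_mul, zero_mul, sum_ite_mem, univ_inter]
  have : ∀ e, (if e ∈ ω then (1 : ℝ) else -1) = 2 * (if e ∈ ω then 1 else 0) - 1 := by
    intro e; split_ifs <;> norm_num
  simp only [this, sum_sub_distrib, ← mul_sum, discrepancy, sum_ite_mem, inter_comm ω R]
  simp

lemma sum_exp_sum_mul_sign {α : Type*} [Fintype α] [DecidableEq α] (c : α → ℝ) :
    ∑ ω : Finset α, Real.exp (∑ e, c e * (if e ∈ ω then (1 : ℝ) else -1)) =
      2 ^ Fintype.card α * ∏ e, Real.cosh (c e) := by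
  have h : ∀ e, Real.exp (c e) + Real.exp (-c e) = 2 * Real.cosh (c e) := by
    intro e; rw [Real.cosh_eq]; ring
  rw [← card_univ, ← prod_const, ← prod_mul_distrib]
  simp_rw [← h]
  rw [Fintype.prod_add]
  refine sum_congr rfl fun ω _ => ?_
  rw [Real.exp_sum, ← prod_mul_prod_compl ω]
  congr 1
  · exact prod_congr rfl fun e he => by simp [he]
  · exact prod_congr rfl fun e he => by simp [mem_compl.1 he]

lemma sum_exp_sum_mul_sign_le {α : Type*} [Fintype α] [DecidableEq α] (c : α → ℝ) :
    ∑ ω : Finset α, Real.exp (∑ e, c e * (if e ∈ ω then (1 : ℝ) else -1)) ≤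
      2 ^ Fintype.card α * Real.exp (∑ e, c e ^ 2 / 2) := by
  rw [sum_exp_sum_mul_sign, Real.exp_sum]
  gcongr
  exact Real.cosh_le_exp_half_sq _

/-- Exponential moment bound for the sum of the absolute discrepancies of a family of sets covering
each point at most twice. -/
lemma sum_exp_sum_abs_discrepancy_le {α V : Type*} [Fintype α] [DecidableEq α] [Fintype V]
    [DecidableEq V] (R : V → Finset α) (hR : ∀ e, #{v | e ∈ R v} ≤ 2) (l : ℝ) :
    ∑ ω : Finset α, Real.exp (l * ∑ v, |discrepancy ω (R v)|) ≤
      2 ^ Fintype.card V * (2 ^ Fintype.card α * Real.exp (l ^ 2 * ∑ v, (#(R v) : ℝ))) := by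
  have h1 : ∀ ω : Finset α, Real.exp (l * ∑ v, |discrepancy ω (R v)|) ≤
      ∑ t : Finset V, Real.exp (∑ e, (∑ v, if e ∈ R v then (if v ∈ t then l else -l) else 0) *
        (if e ∈ ω then (1 : ℝ) else -1)) := by
    intro ω
    calc Real.exp (l * ∑ v, |discrepancy ω (R v)|)
        = ∏ v, Real.exp (l * |discrepancy ω (R v)|) := by rw [mul_sum, Real.exp_sum]
      _ ≤ ∏ v, (Real.exp (l * discrepancy ω (R v)) + Real.exp (-l * discrepancy ω (R v))) := by
        gcongr with v
        rcases abs_cases (discrepancy ω (R v)) with h | h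
        · rw [h.1]; linarith [Real.exp_pos (-l * discrepancy ω (R v))]
        · rw [h.1, mul_neg, ← neg_mul]; linarith [Real.exp_pos (l * discrepancy ω (R v))]
      _ = ∑ t : Finset V, ∏ v, Real.exp ((if v ∈ t then l else -l) * discrepancy ω (R v)) := by
        rw [Fintype.prod_add]
        refine sum_congr rfl fun t _ => ?_
        rw [← prod_mul_prod_compl t]
        congr 1
        · exact prod_congr rfl fun e he => by simp [he]
        · exact prod_congr rfl fun e he => by simp [mem_compl.1 he]
      _ = _ := by
        refine sum_congr rfl fun t _ => ?_
        rw [← Real.exp_sum]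
        congr 1
        simp_rw [discrepancy_eq_sum, mul_sum, sum_mul]
        rw [sum_comm]
        refine sum_congr rfl fun e _ => sum_congr rfl fun v _ => ?_
        split_ifs <;> ring
  calc ∑ ω : Finset α, Real.exp (l * ∑ v, |discrepancy ω (R v)|)
      ≤ ∑ ω : Finset α, ∑ t : Finset V,
        Real.exp (∑ e, (∑ v, if e ∈ R v then (if v ∈ t then l else -l) else 0) *
          (if e ∈ ω then (1 : ℝ) else -1)) := sum_le_sum fun ω _ => h1 ω
    _ = ∑ t : Finset V, ∑ ω : Finset α,
        Real.exp (∑ e, (∑ v, if e ∈ R v then (if v ∈ t then l else -l) else 0) *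
          (if e ∈ ω then (1 : ℝ) else -1)) := sum_comm
    _ ≤ ∑ t : Finset V, 2 ^ Fintype.card α * Real.exp (l ^ 2 * ∑ v, (#(R v) : ℝ)) := by
        refine sum_le_sum fun t _ => (sum_exp_sum_mul_sign_le _).trans ?_
        gcongr
        have h2 : ∀ e, (∑ v, if e ∈ R v then (if v ∈ t then l else -l) else 0) ^ 2 / 2 ≤
            l ^ 2 * (#{v | e ∈ R v} : ℝ) := by
          intro e
          have h3 : (∑ v, if e ∈ R v then (if v ∈ t then l else -l) else 0) ^ 2 ≤
              (#{v | e ∈ R v} : ℝ) * ∑ v with e ∈ R v, (if v ∈ t then l else -l) ^ 2 := by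
            rw [← sum_filter]
            exact sq_sum_le_card_mul_sum_sq
          have h4 : ∑ v with e ∈ R v, (if v ∈ t then l else -l) ^ 2 =
              (#{v | e ∈ R v} : ℝ) * l ^ 2 := by
            rw [← nsmul_eq_mul, ← sum_const]
            refine sum_congr rfl fun v _ => ?_
            split_ifs <;> ring
          rw [h4] at h3
          have h5 : (#{v | e ∈ R v} : ℝ) ≤ 2 := by exact_mod_cast hR e
          have h6 : (#{v | e ∈ R v} : ℝ) * (#{v | e ∈ R v} * l ^ 2) ≤
            2 * (#{v | e ∈ R v} * l ^ 2) := by gcongr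
          linarith
        refine (sum_le_sum fun e _ => h2 e).trans (le_of_eq ?_)
        rw [← mul_sum]
        congr 1
        exact_mod_cast sum_card_bipartiteAbove_eq_sum_card_bipartiteBelow (fun e v => e ∈ R v)
          (s := univ) (t := univ) |>.trans (by simp [bipartiteBelow])
    _ = _ := by simp

lemma exp_sq_div_three_le_cosh {x : ℝ} (hx : x ^ 2 ≤ 1) : Real.exp (x ^ 2 / 3) ≤ Real.cosh x := by
  have h1 : 1 + x ^ 2 / 2 ≤ Real.cosh x := by
    have h2 : |x / 2| ≤ |Real.sinh (x / 2)| := by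
      rw [Real.abs_sinh]
      exact Real.self_le_sinh_iff.2 (abs_nonneg _)
    have h3 := sq_le_sq.2 h2
    have h4 := Real.cosh_two_mul (x / 2)
    rw [Real.cosh_sq, mul_div_cancel₀ x two_ne_zero] at h4
    rw [h4]
    nlinarith
  refine le_trans ?_ h1
  have h2 : Real.exp (x ^ 2 / 3) ≤ 1 / (1 - x ^ 2 / 3) := by
    have := Real.one_sub_le_exp_neg (x ^ 2 / 3)
    rw [Real.exp_neg] at this
    rw [le_div_iff₀ (by linarith)]
    have h3 := Real.exp_pos (x ^ 2 / 3)
    calc Real.exp (x ^ 2 / 3) * (1 - x ^ 2 / 3)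
        ≤ Real.exp (x ^ 2 / 3) * (Real.exp (x ^ 2 / 3))⁻¹ := by gcongr
      _ = 1 := mul_inv_cancel₀ h3.ne'
  refine h2.trans ?_
  rw [div_le_iff₀ (by linarith)]
  nlinarith [sq_nonneg x]

/-- Paley–Zygmund lower bound for the upper tail of the size of a random subset. -/
lemma le_countWhere_discrepancy_ge {α : Type*} [Fintype α] [DecidableEq α] (P : Finset α) (l : ℝ)
    (hl0 : 0 < l) (hl1 : l ≤ 1) :
    1 / 4 * Real.exp (-(2 * l ^ 2 * #P)) * 2 ^ Fintype.card α ≤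
      countWhere (fun ω : Finset α => #P * l / 3 - Real.log 2 / l ≤ discrepancy ω P) := by
  classical
  set F : Finset α → ℝ := fun ω => Real.exp (l * discrepancy ω P) with hF
  set N : ℝ := 2 ^ Fintype.card α with hN
  have hNpos : 0 < N := by positivity
  have hmgf : ∀ x : ℝ, ∑ ω : Finset α, Real.exp (x * discrepancy ω P) = N * Real.cosh x ^ #P := by
    intro x
    have := sum_exp_sum_mul_sign (fun e => if e ∈ P then x else 0)
    rw [hN]
    convert this using 2
    · refine congrArg Real.exp ?_
      rw [discrepancy_eq_sum, mul_sum]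
      refine sum_congr rfl fun e _ => ?_
      split_ifs <;> ring
    · have : ∀ e, Real.cosh (if e ∈ P then x else 0) = if e ∈ P then Real.cosh x else 1 := by
        intro e; split_ifs <;> simp
      simp_rw [this, prod_ite_mem, univ_inter, prod_const]
  have hS1 : ∑ ω, F ω = N * Real.cosh l ^ #P := hmgf l
  have hS2 : ∑ ω, F ω ^ 2 = N * Real.cosh (2 * l) ^ #P := by
    rw [← hmgf]
    refine sum_congr rfl fun ω _ => ?_
    rw [hF, sq, ← Real.exp_add]; ring_nf
  set M : ℝ := Real.cosh l ^ #P with hM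
  have hMpos : 0 < M := by have := Real.cosh_pos l; positivity
  set T : Finset (Finset α) := {ω | M / 2 ≤ F ω} with hT
  have hsplit : ∑ ω, F ω ≤ ∑ ω ∈ T, F ω + N * (M / 2) := by
    rw [← sum_filter_add_sum_filter_not univ (fun ω => M / 2 ≤ F ω)]
    gcongr
    calc ∑ ω with ¬ M / 2 ≤ F ω, F ω ≤ ∑ ω : Finset α with ¬ M / 2 ≤ F ω, M / 2 :=
          sum_le_sum fun ω h => (not_le.1 (mem_filter.1 h).2).le
      _ = (#{ω : Finset α | ¬ M / 2 ≤ F ω} : ℝ) * (M / 2) := by rw [sum_const, nsmul_eq_mul]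
      _ ≤ N * (M / 2) := by
        gcongr
        rw [hN]
        exact_mod_cast (card_filter_le _ _).trans (by simp)
  have hhalf : N * M / 2 ≤ ∑ ω ∈ T, F ω := by rw [hS1] at hsplit; linarith
  have hCS : (∑ ω ∈ T, F ω) ^ 2 ≤ #T * ∑ ω, F ω ^ 2 := by
    refine sq_sum_le_card_mul_sum_sq.trans ?_
    gcongr
    · exact subset_univ _
  have hcosh : Real.cosh (2 * l) ≤ Real.exp (2 * l ^ 2) := by
    refine (Real.cosh_le_exp_half_sq _).trans (le_of_eq ?_)
    ring_nf
  have hcosh2 : Real.cosh (2 * l) ≤ Real.cosh (2 * l) * Real.cosh (2 * l) := by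
    nlinarith [Real.one_le_cosh (2 * l)]
  have hratio : Real.cosh (2 * l) ^ #P * Real.exp (-(2 * l ^ 2 * #P)) ≤ M ^ 2 := by
    have h1 : Real.cosh (2 * l) * Real.exp (-(2 * l ^ 2)) ≤ Real.cosh l ^ 2 := by
      have h2 : Real.cosh (2 * l) * Real.exp (-(2 * l ^ 2)) ≤ 1 := by
        rw [Real.exp_neg, ← div_eq_mul_inv]
        exact div_le_one_of_le₀ hcosh (Real.exp_pos _).le
      exact h2.trans (one_le_pow₀ (Real.one_le_cosh l))
    have h3 : Real.exp (-(2 * l ^ 2 * #P)) = Real.exp (-(2 * l ^ 2)) ^ #P := by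
      rw [← Real.exp_nat_mul]; ring_nf
    rw [h3, ← mul_pow, hM, ← pow_mul, mul_comm #P 2, pow_mul]
    have := Real.cosh_pos (2 * l)
    gcongr
  have hTlow : 1 / 4 * Real.exp (-(2 * l ^ 2 * #P)) * N ≤ #T := by
    have h1 : (N * M / 2) ^ 2 ≤ #T * (N * Real.cosh (2 * l) ^ #P) := by
      rw [← hS2]
      refine le_trans ?_ hCS
      gcongr
    have hc : 0 < Real.cosh (2 * l) ^ #P := by have := Real.cosh_pos (2 * l); positivity
    refine le_of_mul_le_mul_right ?_ (mul_pos hNpos hc)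
    calc 1 / 4 * Real.exp (-(2 * l ^ 2 * #P)) * N * (N * Real.cosh (2 * l) ^ #P)
        = N ^ 2 / 4 * (Real.cosh (2 * l) ^ #P * Real.exp (-(2 * l ^ 2 * #P))) := by ring
      _ ≤ N ^ 2 / 4 * M ^ 2 := by gcongr
      _ = (N * M / 2) ^ 2 := by ring
      _ ≤ _ := h1
  refine hTlow.trans ?_
  rw [countWhere_eq]
  norm_cast
  refine card_le_card fun ω hω => ?_
  simp only [hT, hF, mem_filter, mem_univ, true_and] at hω ⊢
  have h1 : Real.exp (#P * l ^ 2 / 3) ≤ M := by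
    have : Real.exp (#P * l ^ 2 / 3) = Real.exp (l ^ 2 / 3) ^ #P := by
      rw [← Real.exp_nat_mul]; ring_nf
    rw [this, hM]
    gcongr
    exact exp_sq_div_three_le_cosh (by nlinarith)
  have h2 : Real.exp (#P * l ^ 2 / 3 - Real.log 2) ≤ Real.exp (l * discrepancy ω P) := by
    rw [Real.exp_sub, Real.exp_log (by norm_num)]
    exact le_trans (by gcongr) hω
  have h3 := Real.exp_le_exp.1 h2
  have h4 : #P * l / 3 - Real.log 2 / l = (#P * l ^ 2 / 3 - Real.log 2) / l := by
    field_simp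
  rw [h4, div_le_iff₀ hl0]
  linarith

lemma le_countWhere_two_mul_le_discrepancy {α : Type*} [Fintype α] [DecidableEq α] (P : Finset α)
    (hP : 0 < #P) (s : ℝ) (hs : 0 ≤ s) (hsP : 6 * (s + √(#P : ℝ)) ≤ #P) :
    1 / 4 * Real.exp (-(72 * (s + √(#P : ℝ)) ^ 2 / #P)) * 2 ^ Fintype.card α ≤
      countWhere (fun ω : Finset α => 2 * s ≤ discrepancy ω P) := by
  have hp : (0 : ℝ) < #P := by exact_mod_cast hP
  have hsq : 0 < √(#P : ℝ) := Real.sqrt_pos.2 hp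
  set l : ℝ := 6 * (s + √(#P : ℝ)) / #P with hl
  have hl0 : 0 < l := by positivity
  refine le_trans (le_of_eq ?_) ((le_countWhere_discrepancy_ge P l hl0
    ((div_le_one hp).2 hsP)).trans (countWhere_mono fun ω h => le_trans ?_ h))
  · congr 4
    rw [hl]; field_simp; ring
  · have h1 : #P * l / 3 = 2 * s + 2 * √(#P : ℝ) := by rw [hl]; field_simp; ring
    have h2 : Real.log 2 / l ≤ 2 * √(#P : ℝ) := by
      rw [div_le_iff₀ hl0]
      have h3 : Real.log 2 ≤ 1 := by linarith [Real.log_two_lt_d9]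
      have h4 : 6 * √(#P : ℝ) / #P ≤ l := by rw [hl]; gcongr; linarith
      have h5 : 2 * √(#P : ℝ) * (6 * √(#P : ℝ) / #P) = 12 := by
        have := Real.mul_self_sqrt hp.le
        field_simp
        nlinarith
      have h6 : 2 * √(#P : ℝ) * (6 * √(#P : ℝ) / #P) ≤ 2 * √(#P : ℝ) * l := by gcongr
      linarith
    linarith

/-- **Harris–Kleitman inequality** for finitely many increasing properties. -/
lemma prod_mul_le_countWhere_forall {α V : Type*} [Fintype α] [DecidableEq α]
    (q : V → Finset α → Prop) (hq : ∀ v, ∀ ω ω' : Finset α, ω ⊆ ω' → q v ω → q v ω') (c : V → ℝ)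
    (hc : ∀ v, 0 ≤ c v) (hcq : ∀ v, c v * 2 ^ Fintype.card α ≤ countWhere (q v)) (S : Finset V) :
    (∏ v ∈ S, c v) * 2 ^ Fintype.card α ≤ countWhere (fun ω => ∀ v ∈ S, q v ω) := by
  classical
  induction S using Finset.induction_on with
  | empty => simp [countWhere_eq]
  | insert v S hv ih =>
    rw [prod_insert hv]
    have hN : (0 : ℝ) < 2 ^ Fintype.card α := by positivity
    have h1 : IsUpperSet ((({ω | q v ω} : Finset (Finset α)) : Set (Finset α))) := by
      intro ω ω' h h'
      simp only [coe_filter, mem_univ, true_and] at h' ⊢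
      exact hq v ω ω' h h'
    have h2 : IsUpperSet ((({ω | ∀ u ∈ S, q u ω} : Finset (Finset α)) : Set (Finset α))) := by
      intro ω ω' h h'
      simp only [coe_filter, mem_univ, true_and] at h' ⊢
      exact fun u hu => hq u ω ω' h (h' u hu)
    have h3 := h1.le_card_inter_finset h2
    have h4 : countWhere (q v) * countWhere (fun ω => ∀ u ∈ S, q u ω) ≤
        2 ^ Fintype.card α * countWhere (fun ω => ∀ u ∈ insert v S, q u ω) := by
      simp only [countWhere_eq, forall_mem_insert]
      rw [← filter_and] at h3
      exact_mod_cast h3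
    refine le_of_mul_le_mul_left ?_ hN
    refine le_trans ?_ h4
    calc (2 : ℝ) ^ Fintype.card α * (c v * (∏ u ∈ S, c u) * 2 ^ Fintype.card α)
        = (c v * 2 ^ Fintype.card α) * ((∏ u ∈ S, c u) * 2 ^ Fintype.card α) := by ring
      _ ≤ _ := mul_le_mul (hcq v) ih
        (mul_nonneg (prod_nonneg fun u _ => hc u) hN.le) (countWhere_nonneg _)

lemma sum_indicator_le_two_pow {α V : Type*} [Fintype α] [Fintype V] (Q : Finset α → Prop)
    (q : Finset α → V → Prop) (k : ℕ) :
    ∑ ω, Set.indicator {ω : Finset α | Q ω} (fun ω => countWhere (q ω) ^ k) ω ≤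
      2 ^ Fintype.card α * (Fintype.card V : ℝ) ^ k := by
  classical
  calc ∑ ω, Set.indicator {ω : Finset α | Q ω} (fun ω => countWhere (q ω) ^ k) ω
      ≤ ∑ _ω : Finset α, (Fintype.card V : ℝ) ^ k := by
        refine sum_le_sum fun ω _ => ?_
        have h : countWhere (q ω) ≤ Fintype.card V := by
          rw [countWhere_eq]; exact_mod_cast card_le_univ _
        refine (Set.indicator_le_self' (fun _ _ => ?_) ω).trans ?_
        · exact pow_nonneg (countWhere_nonneg _) k
        · exact pow_le_pow_left₀ (countWhere_nonneg _) h k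
    _ = _ := by simp

/-- Markov's inequality for the uniform distribution on a finite type. -/
lemma countWhere_lt_mul_le {β : Type*} [Fintype β] (f : β → ℝ) (hf : ∀ x, 0 ≤ f x) (a : ℝ) :
    countWhere (fun x => a < f x) * a ≤ ∑ x, f x := by
  classical
  rw [countWhere_eq, ← nsmul_eq_mul, ← sum_const]
  refine le_trans (sum_le_sum fun x hx => (mem_filter.1 hx).2.le) ?_
  exact sum_le_sum_of_subset_of_nonneg (subset_univ _) fun x _ _ => hf x

lemma countWhere_add_countWhere_not {β : Type*} [Fintype β] (q : β → Prop) :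
    countWhere q + countWhere (fun x => ¬ q x) = Fintype.card β := by
  classical
  rw [countWhere_eq, countWhere_eq]
  exact_mod_cast card_filter_add_card_filter_not (s := univ) q

lemma sum_card_critical_pow_le_of_discrepancy {α V : Type*} [Fintype α] [DecidableEq α] [Fintype V]
    {n k : ℕ} {c t : ℝ} (hn : 0 < n) (hc : 0 < c) (hkn : 2 * k ≤ c * n)
    (hV : Fintype.card V = 2 * n) (P R : V → Finset α)
    (hPP : ∀ u v, u ≠ v → #(P u ∩ P v) ≤ 1) (hPR : ∀ v, #(P v) + #(R v) + 1 = 2 * n)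
    (hcP : ∀ v, c * n ≤ #(P v)) (ht : |t| ≤ √(n : ℝ)) (Q : Finset α → Prop)
    (hQ : ∀ ω e, Q ω → Q (insert e ω)) (T : Finset α) :
    ∑ ω, Set.indicator {ω : Finset α | Q ω}
        (fun ω => countWhere (fun v : V => (#(ω ∩ P v) : ℝ) = n + t - #(T ∩ R v)) ^ k) ω ≤
      ((2 * k) ^ k + 2 ^ k * (48 * ((10 + 6 * k) * (n * √(n : ℝ)) +
        ∑ v, |discrepancy T (R v)|) / (c * n)) ^ k) * countWhere Q := by
  have hn' : (1 : ℝ) ≤ n := by exact_mod_cast hn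
  have hs1 : 1 ≤ √(n : ℝ) := Real.one_le_sqrt.2 hn'
  have hcn : 0 < c * n := by positivity
  have hkP : ∀ v, 2 * k ≤ #(P v) := fun v => by exact_mod_cast hkn.trans (hcP v)
  have hP : ∀ v, 0 < #(P v) := fun v => by exact_mod_cast hcn.trans_le (hcP v)
  refine (sum_card_critical_pow_le P hPP k hkP hP Q hQ
    (fun v => n + t - #(T ∩ R v))).trans ?_
  refine mul_le_mul_of_nonneg_right ?_ (countWhere_nonneg _)
  have hterm : ∀ v, 48 * (√(#(P v) : ℝ) + |2 * (n + t - #(T ∩ R v)) - (#(P v) : ℝ)| + 3 * k)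
      / #(P v) ≤ 48 * ((5 + 3 * k) * √(n : ℝ) + |discrepancy T (R v)|) / (c * n) := by
    intro v
    have hPRv : (#(P v) : ℝ) + #(R v) + 1 = 2 * n := by exact_mod_cast hPR v
    have h1 : √(#(P v) : ℝ) ≤ 2 * √(n : ℝ) := by
      rw [Real.sqrt_le_left (by positivity), mul_pow, Real.sq_sqrt (by positivity)]
      have : (0 : ℝ) ≤ #(R v) := by positivity
      linarith
    have h2 : |2 * (n + t - #(T ∩ R v)) - (#(P v) : ℝ)| ≤
        3 * √(n : ℝ) + |discrepancy T (R v)| := by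
      have h3 : 2 * (n + t - #(T ∩ R v)) - (#(P v) : ℝ) = 2 * t + 1 - discrepancy T (R v) := by
        rw [discrepancy]; linarith
      rw [h3]
      have h4 := abs_le.1 ht
      rw [abs_le]
      constructor <;> linarith [neg_abs_le (discrepancy T (R v)), le_abs_self (discrepancy T (R v))]
    have h5 : (3 * k : ℝ) ≤ 3 * k * √(n : ℝ) := le_mul_of_one_le_right (by positivity) hs1
    exact div_le_div₀ (by positivity)
      (mul_le_mul_of_nonneg_left (by linarith) (by norm_num)) hcn (hcP v)
  have hsum : ∑ v, 48 * (√(#(P v) : ℝ) + |2 * (n + t - #(T ∩ R v)) - (#(P v) : ℝ)| + 3 * k)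
      / #(P v) ≤ 48 * ((10 + 6 * k) * (n * √(n : ℝ)) + ∑ v, |discrepancy T (R v)|) / (c * n) := by
    refine (sum_le_sum fun v _ => hterm v).trans (le_of_eq ?_)
    rw [← sum_div, ← mul_sum, sum_add_distrib, sum_const, card_univ, hV, nsmul_eq_mul]
    push_cast
    ring
  have hnonneg : 0 ≤ ∑ v, 48 * (√(#(P v) : ℝ) + |2 * (n + t - #(T ∩ R v)) - (#(P v) : ℝ)| + 3 * k)
      / #(P v) := sum_nonneg fun v _ => by positivity
  gcongr

lemma countWhere_sum_discrepancy_lt_le {α V : Type*} [Fintype α] [DecidableEq α] [Fintype V]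
    [DecidableEq V] {n : ℕ} (hn : 0 < n) (hV : Fintype.card V = 2 * n) (R : V → Finset α)
    (hR : ∀ e, #{v | e ∈ R v} ≤ 2) (hRn : ∀ v, #(R v) ≤ 2 * n) (K : ℝ) :
    countWhere (fun T : Finset α => K * (n * √(n : ℝ)) < ∑ v, |discrepancy T (R v)|) ≤
      2 ^ Fintype.card α * Real.exp ((6 - K) * n) := by
  have hn' : (0 : ℝ) < n := by exact_mod_cast hn
  have hs : 0 < √(n : ℝ) := Real.sqrt_pos.2 hn'
  have hss : √(n : ℝ) * √(n : ℝ) = n := Real.mul_self_sqrt hn'.le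
  have h1 := countWhere_lt_mul_le
    (fun T : Finset α => Real.exp (1 / √(n : ℝ) * ∑ v, |discrepancy T (R v)|))
    (fun T => (Real.exp_pos _).le) (Real.exp (K * n))
  have h2 := sum_exp_sum_abs_discrepancy_le R hR (1 / √(n : ℝ))
  have h3 : countWhere (fun T : Finset α => K * (n * √(n : ℝ)) < ∑ v, |discrepancy T (R v)|) ≤
      countWhere (fun T : Finset α => Real.exp (K * n) <
        Real.exp (1 / √(n : ℝ) * ∑ v, |discrepancy T (R v)|)) := by
    refine countWhere_mono fun T h => Real.exp_lt_exp.2 ?_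
    rw [one_div, inv_mul_eq_div, lt_div_iff₀ hs]
    linarith
  have h4 : Real.exp ((1 / √(n : ℝ)) ^ 2 * ∑ v, (#(R v) : ℝ)) ≤ Real.exp (4 * n) := by
    rw [Real.exp_le_exp, div_pow, one_pow, sq, hss, one_div, inv_mul_eq_div, div_le_iff₀ hn']
    calc ∑ v, (#(R v) : ℝ) ≤ ∑ _v : V, (2 * n : ℝ) :=
          sum_le_sum fun v _ => by exact_mod_cast hRn v
      _ = 4 * n * n := by
        rw [sum_const, card_univ, hV, nsmul_eq_mul]; push_cast; ring
  have h5 : (2 : ℝ) ^ Fintype.card V ≤ Real.exp (2 * n) := by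
    rw [hV, show (2 * n : ℝ) = ((2 * n : ℕ) : ℝ) * 1 by push_cast; ring, Real.exp_nat_mul]
    gcongr
    linarith [Real.add_one_le_exp 1]
  have h6 : countWhere (fun T : Finset α => K * (n * √(n : ℝ)) < ∑ v, |discrepancy T (R v)|) *
      Real.exp (K * n) ≤ Real.exp (2 * n) * (2 ^ Fintype.card α * Real.exp (4 * n)) := by
    refine (mul_le_mul_of_nonneg_right h3 (Real.exp_pos _).le).trans (h1.trans (h2.trans ?_))
    gcongr
  refine le_of_mul_le_mul_right (h6.trans (le_of_eq ?_)) (Real.exp_pos (K * n))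
  rw [mul_assoc, ← Real.exp_add, mul_left_comm, ← Real.exp_add]
  ring_nf

lemma half_le_countWhere_sum_exp_le {α V : Type*} [Fintype α] [DecidableEq α] [Fintype V]
    {n : ℕ} (hn : 0 < n) (hV : Fintype.card V = 2 * n) (R : V → Finset α)
    (hRn : ∀ v, #(R v) ≤ 2 * n) :
    2 ^ Fintype.card α / 2 ≤ countWhere (fun T : Finset α =>
      ∑ v, Real.exp (|discrepancy T (R v)| / √(n : ℝ)) ≤ 64 * n) := by
  have hn' : (0 : ℝ) < n := by exact_mod_cast hn
  have h1 : ∀ v, ∑ T : Finset α, Real.exp (|discrepancy T (R v)| / √(n : ℝ)) ≤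
      16 * 2 ^ Fintype.card α := by
    intro v
    have h2 := sum_exp_sum_abs_discrepancy_le (fun _ : Unit => R v)
      (fun e => (card_le_univ _).trans (by simp)) (1 / √(n : ℝ))
    simp only [univ_unique, sum_singleton, Fintype.card_unit, pow_one] at h2
    have h3 : Real.exp ((1 / √(n : ℝ)) ^ 2 * #(R v)) ≤ 8 := by
      rw [div_pow, one_pow, Real.sq_sqrt hn'.le, one_div, inv_mul_eq_div]
      have h4 : (#(R v) : ℝ) / n ≤ 2 := by
        rw [div_le_iff₀ hn']; exact_mod_cast hRn v
      calc Real.exp (#(R v) / n) ≤ Real.exp (1 + 1) := Real.exp_le_exp.2 (by linarith)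
        _ = Real.exp 1 * Real.exp 1 := Real.exp_add _ _
        _ ≤ 2.8 * 2.8 := by
          have := Real.exp_one_lt_d9
          gcongr <;> linarith
        _ ≤ 8 := by norm_num
    calc ∑ T : Finset α, Real.exp (|discrepancy T (R v)| / √(n : ℝ))
        = ∑ T : Finset α, Real.exp (1 / √(n : ℝ) * |discrepancy T (R v)|) := by
          simp only [one_div, inv_mul_eq_div]
      _ ≤ 2 * (2 ^ Fintype.card α * 8) := h2.trans (by gcongr)
      _ = _ := by ring
  have h5 := countWhere_lt_mul_le
    (fun T : Finset α => ∑ v, Real.exp (|discrepancy T (R v)| / √(n : ℝ)))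
    (fun T => sum_nonneg fun v _ => (Real.exp_pos _).le) (64 * n)
  rw [sum_comm] at h5
  have h6 : ∑ v, ∑ T : Finset α, Real.exp (|discrepancy T (R v)| / √(n : ℝ)) ≤
      2 * n * (16 * 2 ^ Fintype.card α) := by
    refine (sum_le_sum fun v _ => h1 v).trans (le_of_eq ?_)
    rw [sum_const, card_univ, hV, nsmul_eq_mul]; push_cast; ring
  have h7 := countWhere_add_countWhere_not (fun T : Finset α =>
    ∑ v, Real.exp (|discrepancy T (R v)| / √(n : ℝ)) ≤ 64 * n)
  simp only [not_le, Fintype.card_finset] at h7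
  push_cast at h7
  have h8 : countWhere (fun T : Finset α =>
      64 * n < ∑ v, Real.exp (|discrepancy T (R v)| / √(n : ℝ))) ≤ 2 ^ Fintype.card α / 2 := by
    refine le_of_mul_le_mul_right ?_ (show (0 : ℝ) < 64 * n by positivity)
    linarith
  linarith

lemma two_pow_mul_exp_le_countWhere {α V : Type*} [Fintype α] [DecidableEq α] [Fintype V]
    {n : ℕ} {c t : ℝ} (hn : 0 < n) (hc : 0 < c) (hn1 : 1990656 / c ^ 4 ≤ n)
    (hn2 : 1296 / c ^ 2 ≤ n) (hV : Fintype.card V = 2 * n) (P R : V → Finset α)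
    (hPn : ∀ v, #(P v) ≤ 2 * n) (hcP : ∀ v, c * n ≤ #(P v)) (ht : |t| ≤ √(n : ℝ))
    (Q : Finset α → Prop) (T : Finset α)
    (hQ : ∀ ω, (∀ v, 2 * t + |discrepancy T (R v)| + 1 ≤ discrepancy ω (P v)) → Q ω)
    (hT : ∑ v, Real.exp (|discrepancy T (R v)| / √(n : ℝ)) ≤ 64 * n) :
    2 ^ Fintype.card α * Real.exp (-((7200 / c + 4) * n)) ≤ countWhere Q := by
  have hn' : (1 : ℝ) ≤ n := by exact_mod_cast hn
  have hn0 : (0 : ℝ) < n := by linarith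
  have hs1 : 1 ≤ √(n : ℝ) := Real.one_le_sqrt.2 hn'
  have hs : 0 < √(n : ℝ) := by linarith
  have hss : √(n : ℝ) ^ 2 = n := Real.sq_sqrt hn0.le
  have hcn : 0 < c * n := by positivity
  have hP : ∀ v, 0 < #(P v) := fun v => by exact_mod_cast hcn.trans_le (hcP v)
  set y : V → ℝ := fun v => |discrepancy T (R v)| / √(n : ℝ) with hy
  have hy0 : ∀ v, 0 ≤ y v := fun v => by positivity
  have hyD : ∀ v, |discrepancy T (R v)| = √(n : ℝ) * y v := fun v => by
    rw [hy]; field_simp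
  have hyn : ∀ v, Real.exp (y v) ≤ 64 * n := fun v =>
    (single_le_sum (f := fun v => Real.exp (y v)) (fun _ _ => (Real.exp_pos _).le)
      (mem_univ v)).trans hT
  have hcs : 36 ≤ c * √(n : ℝ) := by
    refine (pow_le_pow_iff_left₀ (by norm_num) (by positivity) two_ne_zero).1 ?_
    rw [mul_pow, hss]
    rw [div_le_iff₀ (by positivity)] at hn2
    linarith
  have hyc : ∀ v, 6 * y v ≤ c * √(n : ℝ) := by
    intro v
    refine (pow_le_pow_iff_left₀ (by have := hy0 v; positivity) (by positivity)
      four_ne_zero).1 ?_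
    have h1 : y v ^ 4 / 24 ≤ 64 * n := by
      refine le_trans ?_ (hyn v)
      have := Real.pow_div_factorial_le_exp (y v) (hy0 v) 4
      simpa [Nat.factorial] using this
    rw [div_le_iff₀ (by positivity)] at hn1
    have h2 : √(n : ℝ) ^ 4 = n * n := by
      rw [show 4 = 2 * 2 from rfl, pow_mul, hss, sq]
    rw [mul_pow, mul_pow, h2]
    nlinarith
  set s : V → ℝ := fun v => √(n : ℝ) * (3 + y v) / 2 with hsdef
  have hs0 : ∀ v, 0 ≤ s v := fun v => by have := hy0 v; positivity
  have hsp : ∀ v, s v + √(#(P v) : ℝ) ≤ √(n : ℝ) * (6 + y v) / 2 := by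
    intro v
    have h1 : √(#(P v) : ℝ) ≤ 3 / 2 * √(n : ℝ) := by
      rw [Real.sqrt_le_left (by positivity), mul_pow, hss]
      have : (#(P v) : ℝ) ≤ 2 * n := by exact_mod_cast hPn v
      linarith
    rw [hsdef]
    simp only
    linarith
  have h6 : ∀ v, 6 * (s v + √(#(P v) : ℝ)) ≤ #(P v) := by
    intro v
    refine le_trans ?_ (hcP v)
    have h1 : √(n : ℝ) * (3 * (6 + y v)) ≤ √(n : ℝ) * (c * √(n : ℝ)) :=
      mul_le_mul_of_nonneg_left (by linarith [hyc v]) hs.le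
    have h2 : √(n : ℝ) * (c * √(n : ℝ)) = c * n := by
      linear_combination c * hss
    linarith [hsp v]
  have hexp : ∀ v, 72 * (s v + √(#(P v) : ℝ)) ^ 2 / #(P v) ≤ 72 / c * (18 + Real.exp (y v)) := by
    intro v
    have h1 : y v ^ 2 / 2 ≤ Real.exp (y v) := by
      have := Real.pow_div_factorial_le_exp (y v) (hy0 v) 2
      simpa [Nat.factorial] using this
    have h2 : (s v + √(#(P v) : ℝ)) ^ 2 ≤ n * (18 + Real.exp (y v)) := by
      calc (s v + √(#(P v) : ℝ)) ^ 2 ≤ (√(n : ℝ) * (6 + y v) / 2) ^ 2 :=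
            pow_le_pow_left₀ (add_nonneg (hs0 v) (Real.sqrt_nonneg _)) (hsp v) 2
        _ = n * ((6 + y v) ^ 2 / 4) := by rw [div_pow, mul_pow, hss]; ring
        _ ≤ _ := by
          refine mul_le_mul_of_nonneg_left ?_ hn0.le
          nlinarith [sq_nonneg (y v - 6)]
    have h3 := Real.exp_pos (y v)
    calc 72 * (s v + √(#(P v) : ℝ)) ^ 2 / #(P v)
        ≤ 72 * (n * (18 + Real.exp (y v))) / (c * n) :=
          div_le_div₀ (by positivity) (by linarith) hcn (hcP v)
      _ = _ := by field_simp
  have hharris := prod_mul_le_countWhere_forall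
    (fun v ω => 2 * s v ≤ discrepancy ω (P v)) (fun v ω ω' h hω => hω.trans (discrepancy_mono h _))
    (fun v => 1 / 4 * Real.exp (-(72 * (s v + √(#(P v) : ℝ)) ^ 2 / #(P v))))
    (fun v => by positivity)
    (fun v => le_countWhere_two_mul_le_discrepancy (P v) (hP v) (s v) (hs0 v) (h6 v)) univ
  have hprod : Real.exp (-((7200 / c + 4) * n)) ≤
      ∏ v, 1 / 4 * Real.exp (-(72 * (s v + √(#(P v) : ℝ)) ^ 2 / #(P v))) := by
    have h1 : ∀ v, Real.exp (-2 - 72 / c * (18 + Real.exp (y v))) ≤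
        1 / 4 * Real.exp (-(72 * (s v + √(#(P v) : ℝ)) ^ 2 / #(P v))) := by
      intro v
      rw [sub_eq_add_neg, Real.exp_add]
      have h2 : Real.exp (-2) ≤ 1 / 4 := by
        rw [Real.exp_neg, one_div]
        have h3 : (4 : ℝ) ≤ Real.exp 2 := by
          rw [show (2 : ℝ) = 1 + 1 by norm_num, Real.exp_add]
          nlinarith [Real.add_one_le_exp 1]
        gcongr
      have h3 := hexp v
      refine mul_le_mul h2 (Real.exp_le_exp.2 (by linarith)) (Real.exp_pos _).le (by norm_num)
    refine le_trans ?_ (prod_le_prod (fun v _ => (Real.exp_pos _).le) fun v _ => h1 v)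
    rw [← Real.exp_sum, Real.exp_le_exp, sum_sub_distrib, ← mul_sum, sum_add_distrib, sum_const,
      sum_const, card_univ, hV, nsmul_eq_mul, nsmul_eq_mul]
    push_cast
    have h4 : 72 / c * (2 * n * 18 + ∑ v, Real.exp (y v)) ≤ 72 / c * (2 * n * 18 + 64 * n) := by
      gcongr
    have h5 : 72 / c * (2 * n * 18 + 64 * n) = 7200 / c * n := by ring
    linarith
  rw [mul_comm]
  refine (mul_le_mul_of_nonneg_right hprod (by positivity)).trans (hharris.trans
    (countWhere_mono fun ω h => hQ ω fun v => le_trans ?_ (h v (mem_univ v))))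
  rw [hyD, hsdef]
  simp only
  linarith [le_abs_self t]

/-- Conditional moment bound for the number of critical vertices in an abstract two-layer
configuration space: `S` records the same-class coordinates and `T` the cross-class ones. -/
lemma exists_sum_critical_pow_le (c : ℝ) (hc : 0 < c) (k : ℕ) :
    ∃ C : ℝ, 0 < C ∧ ∃ n₀ : ℕ, 0 < n₀ ∧ ∀ n : ℕ, n₀ ≤ n → ∀ (α V : Type) [Fintype α]
      [DecidableEq α] [Fintype V] [DecidableEq V], Fintype.card V = 2 * n →
      ∀ P R : V → Finset α, (∀ u v, u ≠ v → #(P u ∩ P v) ≤ 1) →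
      (∀ v, #(P v) + #(R v) + 1 = 2 * n) → (∀ v, c * n ≤ #(P v)) →
      (∀ e, #{v | e ∈ R v} ≤ 2) → ∀ t : ℝ, |t| ≤ √(n : ℝ) →
      ∀ Q : Finset α → Finset α → Prop, (∀ T S e, Q T S → Q T (insert e S)) →
      (∀ T S, (∀ v, 2 * t + |discrepancy T (R v)| + 1 ≤ discrepancy S (P v)) → Q T S) →
      ∑ T, ∑ S, Set.indicator {S : Finset α | Q T S}
        (fun S => countWhere (fun v : V => (#(S ∩ P v) : ℝ) = n + t - #(T ∩ R v)) ^ k) S ≤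
        C * √(n : ℝ) ^ k * ∑ T, countWhere (Q T) := by
  set C₂ : ℝ := 7200 / c + 4 with hC₂
  set K : ℝ := 7 + C₂ + 2 * k with hK
  set C₁ : ℝ := 48 * (10 + 6 * k + K) / c with hC₁
  have hK0 : 0 < K := by positivity
  obtain ⟨n₀, hn₀⟩ := exists_nat_ge (1990656 / c ^ 4 + 1296 / c ^ 2 + 2 * k / c)
  refine ⟨(2 * k) ^ k + 2 ^ k * C₁ ^ k + 1, by positivity, n₀ + 1, by omega, ?_⟩
  intro n hn α V _ _ _ _ hV P R hPP hPR hcP hR t ht Q hQ hQs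
  have hn0 : 0 < n := by omega
  have hn' : (1 : ℝ) ≤ n := by exact_mod_cast hn0
  have hnn : (n₀ : ℝ) ≤ n := by exact_mod_cast (by omega : n₀ ≤ n)
  have hs1 : 1 ≤ √(n : ℝ) := Real.one_le_sqrt.2 hn'
  have hsk : 1 ≤ √(n : ℝ) ^ k := one_le_pow₀ hs1
  have hp1 : 0 ≤ 1990656 / c ^ 4 := by positivity
  have hp2 : 0 ≤ 1296 / c ^ 2 := by positivity
  have hp3 : 0 ≤ 2 * k / c := by positivity
  have hkn : 2 * k ≤ c * n := by
    rw [← div_le_iff₀' hc]; linarith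
  set N : ℝ := 2 ^ Fintype.card α with hN
  have hN0 : 0 < N := by positivity
  set bad : Finset α → Prop := fun T => K * (n * √(n : ℝ)) < ∑ v, |discrepancy T (R v)| with hbad
  have hbound : ∀ T, ∑ S, Set.indicator {S : Finset α | Q T S}
      (fun S => countWhere (fun v : V => (#(S ∩ P v) : ℝ) = n + t - #(T ∩ R v)) ^ k) S ≤
      ((2 * k) ^ k + 2 ^ k * C₁ ^ k) * √(n : ℝ) ^ k * countWhere (Q T) +
        Set.indicator {T | bad T} (fun _ => (1 : ℝ)) T * (N * (2 * n) ^ k) := by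
    intro T
    by_cases hT : bad T
    · rw [Set.indicator_of_mem (by exact hT), one_mul]
      have h1 := sum_indicator_le_two_pow (Q T)
        (fun S (v : V) => (#(S ∩ P v) : ℝ) = n + t - #(T ∩ R v)) k
      rw [hV] at h1
      push_cast at h1
      have h2 : 0 ≤ ((2 * k) ^ k + 2 ^ k * C₁ ^ k) * √(n : ℝ) ^ k * countWhere (Q T) :=
        mul_nonneg (by positivity) (countWhere_nonneg _)
      linarith
    · rw [Set.indicator_of_notMem (by exact hT), zero_mul, add_zero]
      refine (sum_card_critical_pow_le_of_discrepancy hn0 hc hkn hV P R hPP hPR hcP ht (Q T)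
        (hQ T) T).trans ?_
      refine mul_le_mul_of_nonneg_right ?_ (countWhere_nonneg _)
      rw [show ((2 * (k : ℝ)) ^ k + 2 ^ k * C₁ ^ k) * √(n : ℝ) ^ k =
        (2 * (k : ℝ)) ^ k * √(n : ℝ) ^ k + 2 ^ k * (C₁ * √(n : ℝ)) ^ k by rw [mul_pow C₁]; ring]
      have h3 : 48 * ((10 + 6 * k) * (n * √(n : ℝ)) + ∑ v, |discrepancy T (R v)|) / (c * n) ≤
          C₁ * √(n : ℝ) := by
        rw [div_le_iff₀ (by positivity), hC₁]
        have h4 := not_lt.1 hT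
        have h5 : 48 * (10 + 6 * k + K) / c * √(n : ℝ) * (c * n) =
            48 * ((10 + 6 * k) * (n * √(n : ℝ)) + K * (n * √(n : ℝ))) := by field_simp
        rw [h5]
        linarith
      have h6 : 0 ≤ ∑ v, |discrepancy T (R v)| := sum_nonneg fun v _ => abs_nonneg _
      refine add_le_add (le_mul_of_one_le_right (by positivity) hsk) ?_
      gcongr
  have hbadcard : countWhere bad ≤ N * Real.exp ((6 - K) * n) :=
    countWhere_sum_discrepancy_lt_le hn0 hV R hR (fun v => by have := hPR v; omega) K
  have hlow : N * N * Real.exp (-((C₂ + 1) * n)) ≤ ∑ T, countWhere (Q T) := by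
    have h1 := half_le_countWhere_sum_exp_le hn0 hV R (fun v => by have := hPR v; omega)
    have h2 : ∀ T, Set.indicator {T : Finset α |
        ∑ v, Real.exp (|discrepancy T (R v)| / √(n : ℝ)) ≤ 64 * n} (fun _ => (1 : ℝ)) T *
        (N * Real.exp (-(C₂ * n))) ≤ countWhere (Q T) := by
      intro T
      by_cases hT : ∑ v, Real.exp (|discrepancy T (R v)| / √(n : ℝ)) ≤ 64 * n
      · rw [Set.indicator_of_mem (by exact hT), one_mul]
        exact two_pow_mul_exp_le_countWhere hn0 hc (by linarith) (by linarith) hV P R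
          (fun v => by have := hPR v; omega) hcP ht (Q T) T (hQs T) hT
      · rw [Set.indicator_of_notMem (by exact hT), zero_mul]
        exact countWhere_nonneg _
    refine le_trans ?_ (sum_le_sum fun T _ => h2 T)
    rw [← sum_mul, ← countWhere_eq_sum_indicator]
    refine le_trans ?_ (mul_le_mul_of_nonneg_right h1 (by positivity))
    have h3 : Real.exp (-((C₂ + 1) * n)) ≤ 1 / 2 * Real.exp (-(C₂ * n)) := by
      rw [show -((C₂ + 1) * n) = -(n : ℝ) + -(C₂ * n) by ring, Real.exp_add]
      gcongr
      rw [Real.exp_neg, one_div]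
      gcongr
      linarith [Real.add_one_le_exp (n : ℝ)]
    have h4 := mul_le_mul_of_nonneg_left h3 (show 0 ≤ N * N by positivity)
    linarith
  have hbadsum : countWhere bad * (N * (2 * n) ^ k) ≤ ∑ T, countWhere (Q T) := by
    refine le_trans ?_ hlow
    have h1 : (2 * n : ℝ) ^ k ≤ Real.exp (2 * k * n) := by
      rw [show (2 * k * n : ℝ) = (k : ℝ) * (2 * n) by ring, Real.exp_nat_mul]
      gcongr
      linarith [Real.add_one_le_exp (2 * n : ℝ)]
    calc countWhere bad * (N * (2 * n) ^ k)
        ≤ N * Real.exp ((6 - K) * n) * (N * Real.exp (2 * k * n)) := by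
          refine mul_le_mul hbadcard ?_ (by positivity) (by positivity)
          gcongr
      _ = N * N * (Real.exp ((6 - K) * n) * Real.exp (2 * k * n)) := by ring
      _ = N * N * Real.exp (-((C₂ + 1) * n)) := by
          rw [← Real.exp_add, hK]; ring_nf
  refine (sum_le_sum fun T _ => hbound T).trans ?_
  rw [sum_add_distrib, ← mul_sum, ← sum_mul, ← countWhere_eq_sum_indicator]
  have h1 : 0 ≤ ∑ T, countWhere (Q T) := sum_nonneg fun T _ => countWhere_nonneg _
  have h2 := le_mul_of_one_le_left h1 hsk
  linarith

/-- `1` on `A` and `-1` off `A`. -/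
noncomputable def side {β : Type*} [DecidableEq β] (A : Finset β) (v : β) : ℝ :=
  if v ∈ A then 1 else -1

/-- Whether `v` and `w` lie in the same class of the partition into `A ∆ B` and its complement. -/
def SameClass {β : Type*} (A B : Finset β) (v w : β) : Prop :=
  ((v ∈ A ↔ w ∈ A) ↔ (v ∈ B ↔ w ∈ B))

/-- The degree of `v` into its own part of `A ∪ Aᶜ` minus its degree into the other part. -/
noncomputable def ownDegGap {m : ℕ} (G : SimpleGraph (Fin m)) (A : Finset (Fin m)) (v : Fin m) :
    ℝ :=
  ∑ w, Set.indicator {w | G.Adj v w} (fun w => side A v * side A w) w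

lemma degIn_eq_sum_indicator {m : ℕ} (G : SimpleGraph (Fin m)) (v : Fin m) (A : Finset (Fin m)) :
    (degIn G v A : ℝ) = ∑ w, Set.indicator {w | G.Adj v w} (fun w => if w ∈ A then 1 else 0) w := by
  classical
  rw [degIn, Nat.card_eq_fintype_card, Fintype.card_subtype]
  simp only [Set.indicator_apply, Set.mem_ofPred_eq, ← ite_and, sum_boole]
  simp only [and_comm]

lemma degIn_sub_degIn_compl {m : ℕ} (G : SimpleGraph (Fin m)) (v : Fin m) (A : Finset (Fin m)) :
    (degIn G v A : ℝ) - degIn G v Aᶜ = side A v * ownDegGap G A v := by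
  classical
  rw [degIn_eq_sum_indicator, degIn_eq_sum_indicator, ownDegGap, mul_sum, ← sum_sub_distrib]
  refine sum_congr rfl fun w _ => ?_
  simp only [Set.indicator_apply, Set.mem_ofPred_eq, side, mem_compl]
  split_ifs <;> simp_all

lemma friendlyPair_iff {m : ℕ} (G : SimpleGraph (Fin m)) (A : Finset (Fin m)) (t : ℝ) :
    FriendlyPair G A t ↔ ∀ v, t ≤ ownDegGap G A v := by
  constructor
  · rintro ⟨h1, h2⟩ v
    have h := degIn_sub_degIn_compl G v A
    by_cases hv : v ∈ A
    · have := h1 v hv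
      rw [side, if_pos hv] at h
      linarith
    · have := h2 v (mem_compl.2 hv)
      rw [side, if_neg hv] at h
      linarith
  · refine fun h => ⟨fun v hv => ?_, fun v hv => ?_⟩
    all_goals
      have h1 := degIn_sub_degIn_compl G v A
      have h2 := h v
    · rw [side, if_pos hv] at h1
      linarith
    · rw [side, if_neg (mem_compl.1 hv)] at h1
      linarith

lemma critCount_eq_countWhere {m : ℕ} (G : SimpleGraph (Fin m)) (A : Finset (Fin m)) (t : ℝ) :
    (critCount G A t : ℝ) = countWhere (fun v => ownDegGap G A v = t) := by
  classical
  rw [critCount, Nat.card_eq_fintype_card, Fintype.card_subtype, countWhere_eq]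
  norm_cast
  congr 1
  ext v
  simp only [mem_filter, mem_univ, true_and]
  have h := degIn_sub_degIn_compl G v A
  by_cases hv : v ∈ A
  · rw [side, if_pos hv] at h
    simp only [hv, mem_compl, true_and, not_true, false_and, or_false]
    constructor <;> intro h' <;> linarith
  · rw [side, if_neg hv] at h
    simp only [hv, mem_compl, true_and, not_false_iff, false_and, false_or]
    constructor <;> intro h' <;> linarith

lemma sum_side {n : ℕ} (A : Finset (Fin (2 * n))) (hA : #A = n) : ∑ w, side A w = 0 := by
  have h : ∀ w, side A w = 2 * (if w ∈ A then 1 else 0) - 1 := by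
    intro w; rw [side]; split_ifs <;> norm_num
  simp only [h, sum_sub_distrib, ← mul_sum]
  simp [hA]

lemma side_mul_side {β : Type*} [DecidableEq β] (A : Finset β) (v w : β)
    [Decidable (v ∈ A ↔ w ∈ A)] :
    side A v * side A w = if (v ∈ A ↔ w ∈ A) then 1 else -1 := by
  simp only [side]
  split_ifs <;> simp_all

open scoped Classical in
lemma two_mul_ownDegGap_add_one {n : ℕ} (G : SimpleGraph (Fin (2 * n))) (A : Finset (Fin (2 * n)))
    (hA : #A = n) (v : Fin (2 * n)) :
    2 * ownDegGap G A v + 1 =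
      ∑ w with w ≠ v, if (G.Adj v w ↔ (v ∈ A ↔ w ∈ A)) then 1 else -1 := by
  have h1 : ∑ w with w ≠ v, side A v * side A w = -1 := by
    have h2 : ∑ w, side A v * side A w = 0 := by rw [← mul_sum, sum_side A hA, mul_zero]
    rw [← sum_filter_add_sum_filter_not univ (fun w => w ≠ v)] at h2
    have h3 : ∑ w with ¬ w ≠ v, side A v * side A w = 1 := by
      simp [side_mul_side, filter_eq']
    linarith
  have h4 : ownDegGap G A v =
      ∑ w with w ≠ v, Set.indicator {w | G.Adj v w} (fun w => side A v * side A w) w := by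
    rw [ownDegGap, sum_filter]
    refine sum_congr rfl fun w _ => ?_
    split_ifs with h
    · rfl
    · simp [not_not.1 h]
  have h5 : 2 * ownDegGap G A v + 1 =
      2 * ownDegGap G A v - ∑ w with w ≠ v, side A v * side A w := by
    rw [h1]; ring
  rw [h5, h4, mul_sum, ← sum_sub_distrib]
  refine sum_congr rfl fun w _ => ?_
  simp only [side_mul_side, Set.indicator_apply, Set.mem_ofPred_eq]
  split_ifs <;> first | (exfalso; tauto) | norm_num

/-- The graph encoded by a pair of sets of edges, where `S` is read on pairs of vertices in the same
class and `T` on the other pairs: a pair of vertices belongs to the relevant set if and only if it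
is adjacent exactly when contained in a part of `A ∪ Aᶜ`. -/
def graphOfConfig {m : ℕ} (A B : Finset (Fin m)) (T S : Finset (Sym2 (Fin m))) :
    SimpleGraph (Fin m) where
  Adj u v := u ≠ v ∧ (((SameClass A B u v ∧ s(u, v) ∈ S) ∨ (¬ SameClass A B u v ∧ s(u, v) ∈ T)) ↔
    (u ∈ A ↔ v ∈ A))
  symm := ⟨fun u v h => by
    have h1 : SameClass A B v u ↔ SameClass A B u v := by simp only [SameClass]; tauto
    rw [Sym2.eq_swap, h1]
    tauto⟩
  loopless := ⟨fun v h => h.1 rfl⟩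

open scoped Classical in
/-- The edges from `v` to the rest of its class. -/
noncomputable def sameStar {m : ℕ} (A B : Finset (Fin m)) (v : Fin m) : Finset (Sym2 (Fin m)) :=
  ({w | w ≠ v ∧ SameClass A B v w} : Finset (Fin m)).image fun w => s(v, w)

open scoped Classical in
/-- The edges from `v` to the other class. -/
noncomputable def crossStar {m : ℕ} (A B : Finset (Fin m)) (v : Fin m) : Finset (Sym2 (Fin m)) :=
  ({w | w ≠ v ∧ ¬ SameClass A B v w} : Finset (Fin m)).image fun w => s(v, w)

lemma mk_right_injective {β : Type*} (v : β) : Function.Injective fun w => s(v, w) :=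
  fun _ _ h => Sym2.congr_right.1 h

lemma discrepancy_image_star {m : ℕ} (ω : Finset (Sym2 (Fin m))) (v : Fin m) (W : Finset (Fin m)) :
    discrepancy ω (W.image fun w => s(v, w)) = ∑ w ∈ W, if s(v, w) ∈ ω then (1 : ℝ) else -1 := by
  rw [discrepancy_eq_sum]
  simp only [ite_mul, one_mul, zero_mul, sum_ite_mem, univ_inter]
  exact sum_image fun _ _ _ _ h => mk_right_injective v h

lemma ownDegGap_graphOfConfig_left {n : ℕ} (A B : Finset (Fin (2 * n))) (hA : #A = n)
    (T S : Finset (Sym2 (Fin (2 * n)))) (v : Fin (2 * n)) :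
    2 * ownDegGap (graphOfConfig A B T S) A v + 1 =
      discrepancy S (sameStar A B v) + discrepancy T (crossStar A B v) := by
  classical
  rw [two_mul_ownDegGap_add_one _ A hA, sameStar, crossStar, discrepancy_image_star,
    discrepancy_image_star,
    ← sum_filter_add_sum_filter_not ({w | w ≠ v} : Finset _) (fun w => SameClass A B v w),
    filter_filter, filter_filter]
  congr 1 <;>
  · refine sum_congr rfl fun w hw => ?_
    simp only [mem_filter, mem_univ, true_and] at hw
    refine if_congr ?_ rfl rfl
    simp only [graphOfConfig, hw]
    have := hw.1.symm
    tauto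

lemma ownDegGap_graphOfConfig_right {n : ℕ} (A B : Finset (Fin (2 * n))) (hB : #B = n)
    (T S : Finset (Sym2 (Fin (2 * n)))) (v : Fin (2 * n)) :
    2 * ownDegGap (graphOfConfig A B T S) B v + 1 =
      discrepancy S (sameStar A B v) - discrepancy T (crossStar A B v) := by
  classical
  rw [two_mul_ownDegGap_add_one _ B hB, sameStar, crossStar, discrepancy_image_star,
    discrepancy_image_star,
    ← sum_filter_add_sum_filter_not ({w | w ≠ v} : Finset _) (fun w => SameClass A B v w),
    filter_filter, filter_filter, sub_eq_add_neg, ← sum_neg_distrib]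
  congr 1
  · refine sum_congr rfl fun w hw => ?_
    simp only [mem_filter, mem_univ, true_and] at hw
    refine if_congr ?_ rfl rfl
    have h1 := hw.1.symm
    have h2 := hw.2
    clear hw
    simp only [graphOfConfig]
    rw [SameClass] at h2 ⊢
    generalize (v ∈ A ↔ w ∈ A) = p at *
    generalize (v ∈ B ↔ w ∈ B) = q at *
    generalize (s(v, w) ∈ S) = a
    generalize (s(v, w) ∈ T) = b
    grind only
  · refine sum_congr rfl fun w hw => ?_
    simp only [mem_filter, mem_univ, true_and] at hw
    have h1 := hw.1.symm
    have h2 := hw.2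
    rw [neg_ite, neg_neg, ← ite_not]
    refine if_congr ?_ rfl rfl
    clear hw
    simp only [graphOfConfig]
    rw [SameClass] at h2 ⊢
    generalize (v ∈ A ↔ w ∈ A) = p at *
    generalize (v ∈ B ↔ w ∈ B) = q at *
    generalize (s(v, w) ∈ S) = a
    generalize (s(v, w) ∈ T) = b
    grind only

lemma card_sameStar {m : ℕ} (A B : Finset (Fin m)) (v : Fin m) [DecidablePred (SameClass A B v)] :
    #(sameStar A B v) + 1 = #{w | SameClass A B v w} := by
  classical
  have h : SameClass A B v v := by simp [SameClass]
  rw [sameStar, card_image_of_injective _ (mk_right_injective v)]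
  rw [← card_erase_add_one (s := {w | SameClass A B v w}) (a := v) (by simp [h])]
  congr 2
  ext w
  simp

lemma card_sameStar_add_card_crossStar {m : ℕ} (A B : Finset (Fin m)) (v : Fin m) :
    #(sameStar A B v) + #(crossStar A B v) + 1 = m := by
  classical
  rw [sameStar, crossStar, card_image_of_injective _ (mk_right_injective v),
    card_image_of_injective _ (mk_right_injective v), ← filter_filter, ← filter_filter,
    card_filter_add_card_filter_not, filter_ne', card_erase_add_one (mem_univ v), card_univ,
    Fintype.card_fin]

lemma le_card_sameStar {n : ℕ} (A B : Finset (Fin (2 * n))) (hA : #A = n) (hB : #B = n)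
    (v : Fin (2 * n)) :
    #(sameStar A B v) + 1 = 2 * #(A ∩ B) ∨ #(sameStar A B v) + 1 + 2 * #(A ∩ B) = 2 * n := by
  classical
  rw [card_sameStar]
  have h1 : #(A \ B) + #(A ∩ B) = n := by rw [card_sdiff_add_card_inter, hA]
  have h2 : #(B \ A) + #(A ∩ B) = n := by rw [inter_comm, card_sdiff_add_card_inter, hB]
  have h3 : #({w | ¬ (w ∈ A ↔ w ∈ B)} : Finset (Fin (2 * n))) = #(A \ B) + #(B \ A) := by
    rw [← card_union_of_disjoint disjoint_sdiff_sdiff]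
    congr 1
    ext w
    simp only [mem_filter, mem_univ, true_and, mem_union, mem_sdiff]
    tauto
  have h4 := card_filter_add_card_filter_not (s := (univ : Finset (Fin (2 * n))))
    (fun w => w ∈ A ↔ w ∈ B)
  rw [card_univ, Fintype.card_fin] at h4
  by_cases hv : v ∈ A ↔ v ∈ B
  · left
    have : ({w | SameClass A B v w} : Finset (Fin (2 * n))) = ({w | w ∈ A ↔ w ∈ B} : Finset _) := by
      ext w
      rw [mem_filter, mem_filter, SameClass]
      tauto
    rw [this]
    omega
  · right
    have : ({w | SameClass A B v w} : Finset (Fin (2 * n))) =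
        ({w | ¬ (w ∈ A ↔ w ∈ B)} : Finset _) := by
      ext w
      rw [mem_filter, mem_filter, SameClass]
      tauto
    rw [this]
    omega

lemma card_sameStar_inter_le {m : ℕ} (A B : Finset (Fin m)) {u v : Fin m} (huv : u ≠ v) :
    #(sameStar A B u ∩ sameStar A B v) ≤ 1 := by
  classical
  refine (card_le_card (t := {s(u, v)}) fun e he => ?_).trans (card_singleton _).le
  simp only [sameStar, mem_inter, mem_image] at he
  obtain ⟨⟨w, -, rfl⟩, x, -, h⟩ := he
  rw [mem_singleton]
  have hv : v ∈ s(u, w) := h ▸ Sym2.mem_mk_left v x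
  rcases Sym2.mem_iff.1 hv with h1 | h1
  · exact absurd h1.symm huv
  · rw [h1]

lemma card_mem_crossStar_le {m : ℕ} (A B : Finset (Fin m)) (e : Sym2 (Fin m)) :
    #{v | e ∈ crossStar A B v} ≤ 2 := by
  induction e using Sym2.ind with
  | _ x y =>
    refine (card_le_card (t := {x, y}) fun v hv => ?_).trans card_le_two
    rw [mem_filter, crossStar, mem_image] at hv
    obtain ⟨-, w, -, h⟩ := hv
    have hv : v ∈ s(x, y) := h ▸ Sym2.mem_mk_left v w
    simpa using hv

/-- The graph encoded by a uniformly random configuration is uniformly random. -/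
lemma card_mul_sum_graphOfConfig {m : ℕ} (A B : Finset (Fin m)) (f : SimpleGraph (Fin m) → ℝ) :
    (Fintype.card (SimpleGraph (Fin m)) : ℝ) * ∑ T, ∑ S, f (graphOfConfig A B T S) =
      (Fintype.card (Finset (Sym2 (Fin m))) : ℝ) ^ 2 * ∑ G, f G := by
  classical
  have h1 : ∀ G, ∑ T, ∑ S, f (graphOfConfig A B T S) =
      ∑ T, ∑ S, f (symmDiff (graphOfConfig A B T S) G) := by
    intro G
    set D : Finset (Sym2 (Fin m)) := {e | e ∈ G.edgeSet} with hD
    have h2 : ∀ T S, symmDiff (graphOfConfig A B T S) G =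
        graphOfConfig A B (symmDiff T D) (symmDiff S D) := by
      intro T S
      ext u v
      have h3 : s(u, v) ∈ D ↔ G.Adj u v := by simp [hD]
      have h4 : G.Adj u v → u ≠ v := fun h => h.ne
      simp only [symmDiff_def, SimpleGraph.sup_adj, SimpleGraph.sdiff_adj, graphOfConfig,
        sup_eq_union, mem_union, mem_sdiff, h3]
      clear h3
      generalize SameClass A B u v = c
      generalize (s(u, v) ∈ S) = a
      generalize (s(u, v) ∈ T) = b
      generalize (u ∈ A ↔ v ∈ A) = d
      generalize G.Adj u v = g at *
      grind only
    have hinv : Function.Involutive fun X : Finset (Sym2 (Fin m)) => symmDiff X D :=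
      fun X => symmDiff_symmDiff_cancel_right D X
    simp only [h2]
    rw [← Equiv.sum_comp hinv.toPerm]
    refine sum_congr rfl fun T _ => ?_
    rw [← Equiv.sum_comp hinv.toPerm]
    rfl
  have h5 : ∀ H : SimpleGraph (Fin m), ∑ G, f (symmDiff H G) = ∑ G, f G := by
    intro H
    have hinv : Function.Involutive fun X : SimpleGraph (Fin m) => symmDiff H X :=
      fun X => symmDiff_symmDiff_cancel_left H X
    exact Equiv.sum_comp hinv.toPerm f
  calc (Fintype.card (SimpleGraph (Fin m)) : ℝ) * ∑ T, ∑ S, f (graphOfConfig A B T S)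
      = ∑ G, ∑ T, ∑ S, f (symmDiff (graphOfConfig A B T S) G) := by
        rw [← card_univ, ← nsmul_eq_mul, ← sum_const]
        exact sum_congr rfl fun G _ => h1 G
    _ = ∑ T, ∑ S, ∑ G, f (symmDiff (graphOfConfig A B T S) G) := by
        rw [sum_comm]
        exact sum_congr rfl fun T _ => sum_comm
    _ = _ := by
        simp only [h5, sum_const, card_univ, nsmul_eq_mul]
        ring

/-- Transfer of the moment bound from configurations to graphs. -/
lemma graphCondExp_le_of_sum_config_le {m : ℕ} (A B : Finset (Fin m))
    (E : SimpleGraph (Fin m) → Prop) (Z : SimpleGraph (Fin m) → ℝ) (C : ℝ)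
    (h : ∑ T, ∑ S, Set.indicator {S | E (graphOfConfig A B T S)}
      (fun S => Z (graphOfConfig A B T S)) S ≤
        C * ∑ T, countWhere (fun S => E (graphOfConfig A B T S))) :
    graphCondExp m E Z ≤ C * graphProb m E := by
  classical
  have h1 := card_mul_sum_graphOfConfig A B (Set.indicator {G | E G} Z)
  have h2 := card_mul_sum_graphOfConfig A B (Set.indicator {G | E G} fun _ => 1)
  have h3 : (0 : ℝ) < Fintype.card (SimpleGraph (Fin m)) := by exact_mod_cast Fintype.card_pos
  have h4 : (0 : ℝ) < (Fintype.card (Finset (Sym2 (Fin m))) : ℝ) ^ 2 := by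
    have : 0 < Fintype.card (Finset (Sym2 (Fin m))) := Fintype.card_pos
    positivity
  have h5 : ∑ G, Set.indicator {G | E G} (fun _ => (1 : ℝ)) G =
      (Nat.card {G : SimpleGraph (Fin m) // E G} : ℝ) := by
    rw [← countWhere_eq_sum_indicator, countWhere_eq, Nat.card_eq_fintype_card,
      Fintype.card_subtype]
  rw [h5] at h2
  have h6 : ∑ G, Set.indicator {G | E G} Z G ≤
      C * (Nat.card {G : SimpleGraph (Fin m) // E G} : ℝ) := by
    refine le_of_mul_le_mul_left ?_ h4
    rw [← h1, mul_left_comm, ← h2, mul_left_comm]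
    refine mul_le_mul_of_nonneg_left ?_ h3.le
    simp only [countWhere_eq_sum_indicator] at h
    exact h
  rw [graphCondExp, graphProb, ← mul_div_assoc]
  gcongr

lemma friendlyPair_graphOfConfig_left_iff {n : ℕ} {A B : Finset (Fin (2 * n))} (hA : #A = n)
    (T S : Finset (Sym2 (Fin (2 * n)))) (t : ℝ) :
    FriendlyPair (graphOfConfig A B T S) A t ↔ ∀ v, 2 * t + 1 ≤
      discrepancy S (sameStar A B v) + discrepancy T (crossStar A B v) := by
  rw [friendlyPair_iff]
  refine forall_congr' fun v => ?_
  rw [← ownDegGap_graphOfConfig_left A B hA T S v]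
  constructor <;> intro h <;> linarith

lemma friendlyPair_graphOfConfig_right_iff {n : ℕ} {A B : Finset (Fin (2 * n))} (hB : #B = n)
    (T S : Finset (Sym2 (Fin (2 * n)))) (t : ℝ) :
    FriendlyPair (graphOfConfig A B T S) B t ↔ ∀ v, 2 * t + 1 ≤
      discrepancy S (sameStar A B v) - discrepancy T (crossStar A B v) := by
  rw [friendlyPair_iff]
  refine forall_congr' fun v => ?_
  rw [← ownDegGap_graphOfConfig_right A B hB T S v]
  constructor <;> intro h <;> linarith

lemma critCount_graphOfConfig {n : ℕ} {A B : Finset (Fin (2 * n))} (hA : #A = n)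
    (T S : Finset (Sym2 (Fin (2 * n)))) (t : ℝ) :
    (critCount (graphOfConfig A B T S) A t : ℝ) = countWhere (fun v =>
      (#(S ∩ sameStar A B v) : ℝ) = n + t - #(T ∩ crossStar A B v)) := by
  rw [critCount_eq_countWhere]
  congr 1
  funext v
  have h1 := ownDegGap_graphOfConfig_left A B hA T S v
  have h2 : (#(sameStar A B v) : ℝ) + #(crossStar A B v) + 1 = 2 * n := by
    exact_mod_cast card_sameStar_add_card_crossStar A B v
  rw [discrepancy, discrepancy] at h1
  refine propext ⟨fun h => ?_, fun h => ?_⟩ <;> linarith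

lemma mul_le_card_sameStar {n : ℕ} {c : ℝ} (hcn : 1 ≤ c * n) {A B : Finset (Fin (2 * n))}
    (hA : #A = n) (hB : #B = n) (h1 : c * n ≤ (#(A ∩ B) : ℝ)) (h2 : (#(A ∩ B) : ℝ) ≤ (1 - c) * n)
    (v : Fin (2 * n)) : c * n ≤ (#(sameStar A B v) : ℝ) := by
  rcases le_card_sameStar A B hA hB v with h | h
  · have h' : (#(sameStar A B v) : ℝ) + 1 = 2 * #(A ∩ B) := by exact_mod_cast h
    linarith
  · have h' : (#(sameStar A B v) : ℝ) + 1 + 2 * #(A ∩ B) = 2 * n := by exact_mod_cast h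
    linarith

end

/-- Fix `c > 0` and a positive integer `k`. There are `C > 0` and `n₀`
such that for all `n ≥ n₀`, `γ ∈ [−1,1]` with `γ√n ∈ ℤ`, and bisections `A ∪ Aᶜ`,
`B ∪ Bᶜ` of `[2n]` with `cn ≤ |A ∩ B| ≤ (1−c)n`: letting `X` be the number of vertices
critical for `A`, one has `E[X^k | E_b] ≤ C n^{k/2}` for `b ∈ {1,2}`, stated as
`E[X^k · 1_{E_b}] ≤ C n^{k/2} · P[E_b]`. -/
theorem critical_vertex_conditional_moments
    (c : ℝ) (hc : 0 < c) (k : ℕ) (hk : 0 < k) :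
    ∃ C : ℝ, 0 < C ∧ ∃ n₀ : ℕ, ∀ n : ℕ, n₀ ≤ n →
      ∀ γ : ℝ, |γ| ≤ 1 → (∃ z : ℤ, γ * Real.sqrt n = (z : ℝ)) →
      ∀ A B : Finset (Fin (2 * n)), A.card = n → B.card = n →
        c * n ≤ ((A ∩ B).card : ℝ) → ((A ∩ B).card : ℝ) ≤ (1 - c) * n →
        (graphCondExp (2 * n) (fun G => FriendlyPair G A (γ * Real.sqrt n))
              (fun G => (critCount G A (γ * Real.sqrt n) : ℝ) ^ k)
            ≤ C * (n : ℝ) ^ ((k : ℝ) / 2) *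
              graphProb (2 * n) (fun G => FriendlyPair G A (γ * Real.sqrt n))) ∧
        (graphCondExp (2 * n)
              (fun G => FriendlyPair G A (γ * Real.sqrt n) ∧
                FriendlyPair G B (γ * Real.sqrt n))
              (fun G => (critCount G A (γ * Real.sqrt n) : ℝ) ^ k)
            ≤ C * (n : ℝ) ^ ((k : ℝ) / 2) *
              graphProb (2 * n) (fun G =>
                FriendlyPair G A (γ * Real.sqrt n) ∧
                FriendlyPair G B (γ * Real.sqrt n))) := by
  obtain ⟨C, hC, n₀, hn₀, hmain⟩ := exists_sum_critical_pow_le c hc k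
  obtain ⟨n₁, hn₁⟩ := exists_nat_ge (1 / c)
  refine ⟨C, hC, n₀ + n₁, fun n hn γ hγ _ A B hA hB hAB₁ hAB₂ => ?_⟩
  have hcn : 1 ≤ c * n := by
    rw [← div_le_iff₀' hc]
    exact hn₁.trans (by exact_mod_cast (by omega : n₁ ≤ n))
  have ht : |γ * √(n : ℝ)| ≤ √(n : ℝ) := by
    rw [abs_mul, abs_of_nonneg (Real.sqrt_nonneg _)]
    exact mul_le_of_le_one_left (Real.sqrt_nonneg _) hγ
  have hpow : (n : ℝ) ^ ((k : ℝ) / 2) = √(n : ℝ) ^ k := by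
    rw [Real.sqrt_eq_rpow, ← Real.rpow_natCast, ← Real.rpow_mul (Nat.cast_nonneg n)]
    ring_nf
  rw [hpow]
  have hbound := hmain n (by omega) (Sym2 (Fin (2 * n))) (Fin (2 * n)) (Fintype.card_fin _)
    (sameStar A B) (crossStar A B) (fun u v => card_sameStar_inter_le A B)
    (card_sameStar_add_card_crossStar A B) (mul_le_card_sameStar hcn hA hB hAB₁ hAB₂)
    (card_mem_crossStar_le A B) (γ * √(n : ℝ)) ht
  have hinsert : ∀ (S : Finset (Sym2 (Fin (2 * n)))) e v,
      discrepancy S (sameStar A B v) ≤ discrepancy (insert e S) (sameStar A B v) :=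
    fun S e v => discrepancy_mono (Finset.subset_insert e S) _
  constructor
  · refine graphCondExp_le_of_sum_config_le A B _ _ _ ?_
    simp only [critCount_graphOfConfig hA]
    refine hbound _ (fun T S e h => ?_) (fun T S h => ?_)
    · rw [friendlyPair_graphOfConfig_left_iff hA] at h ⊢
      exact fun v => (h v).trans (by linarith [hinsert S e v])
    · rw [friendlyPair_graphOfConfig_left_iff hA]
      exact fun v => by linarith [h v, neg_abs_le (discrepancy T (crossStar A B v))]
  · refine graphCondExp_le_of_sum_config_le A B _ _ _ ?_
    simp only [critCount_graphOfConfig hA]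
    refine hbound _ (fun T S e h => ?_) (fun T S h => ?_)
    · rw [friendlyPair_graphOfConfig_left_iff hA, friendlyPair_graphOfConfig_right_iff hB] at h ⊢
      exact ⟨fun v => (h.1 v).trans (by linarith [hinsert S e v]),
        fun v => (h.2 v).trans (by linarith [hinsert S e v])⟩
    · rw [friendlyPair_graphOfConfig_left_iff hA, friendlyPair_graphOfConfig_right_iff hB]
      exact ⟨fun v => by linarith [h v, neg_abs_le (discrepancy T (crossStar A B v))],
        fun v => by linarith [h v, le_abs_self (discrepancy T (crossStar A B v))]⟩
end

section
/- Fix β ∈ [0,1] and γ ∈ ℝ, and let Z_1, Z_2 be independent standard normals. The function h(α_1, α_2) := P[ √(β/2)·Z_1 + √((1−β)/2)·Z_2 ≥ (γ + α_1)√2 and √(β/2)·Z_1 − √((1−β)/2)·Z_2 ≥ (γ + α_2)√2 ] is log-concave on ℝ²: for all (α_1,α_2), (α_1',α_2') ∈ ℝ² and λ ∈ [0,1], h(λ(α_1,α_2) + (1−λ)(α_1',α_2')) ≥ h(α_1,α_2)^λ · h(α_1',α_2')^{1−λ}. -/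
open MeasureTheory ProbabilityTheory

/-- The law of a pair of independent standard Gaussians. -/
noncomputable def gauss2 : Measure (ℝ × ℝ) :=
  (gaussianReal 0 1).prod (gaussianReal 0 1)

/-- `h(α₁,α₂) = P[√(β/2)Z₁ + √((1−β)/2)Z₂ ≥ (γ+α₁)√2 ∧ √(β/2)Z₁ − √((1−β)/2)Z₂ ≥ (γ+α₂)√2]`
for independent standard Gaussians `Z₁, Z₂`. -/
noncomputable def cornerProb (β γ α₁ α₂ : ℝ) : ℝ :=
  (gauss2 {p : ℝ × ℝ |
      (γ + α₁) * Real.sqrt 2 ≤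
        Real.sqrt (β / 2) * p.1 + Real.sqrt ((1 - β) / 2) * p.2 ∧
      (γ + α₂) * Real.sqrt 2 ≤
        Real.sqrt (β / 2) * p.1 - Real.sqrt ((1 - β) / 2) * p.2}).toReal

/-- One-dimensional Brunn–Minkowski inequality. -/
lemma volume_add_le_of_add_mem {A B C : Set ℝ} (hA : MeasurableSet A) (hB : MeasurableSet B)
    (hA' : A.Nonempty) (hB' : B.Nonempty) (h : ∀ a ∈ A, ∀ b ∈ B, a + b ∈ C) :
    volume A + volume B ≤ volume C := by
  have trans_left (a : ℝ) (ha : a ∈ A) : volume B ≤ volume C := by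
    rw [← measure_preimage_add volume (-a) B]
    refine measure_mono fun x hx => ?_
    simpa using h a ha _ hx
  have trans_right (b : ℝ) (hb : b ∈ B) : volume A ≤ volume C := by
    rw [← measure_preimage_add_right volume (-b) A]
    refine measure_mono fun x hx => ?_
    simpa using h _ hx b hb
  obtain ⟨a₀, ha₀⟩ := hA'
  obtain ⟨b₀, hb₀⟩ := hB'
  rcases eq_or_ne (volume A) 0 with h0 | h0
  · simpa [h0] using trans_left a₀ ha₀
  rcases eq_or_ne (volume B) 0 with h1 | h1
  · simpa [h1] using trans_right b₀ hb₀
  refine le_of_forall_lt fun r hr => ?_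
  obtain ⟨s, hs, t, ht, hst⟩ := ENNReal.exists_lt_add_of_lt_add hr h0 h1
  obtain ⟨K, hKA, hK, hsK⟩ := hA.exists_lt_isCompact hs
  obtain ⟨L, hLB, hL, htL⟩ := hB.exists_lt_isCompact ht
  have hKn : K.Nonempty := nonempty_of_measure_ne_zero hsK.ne_bot
  have hLn : L.Nonempty := nonempty_of_measure_ne_zero htL.ne_bot
  obtain ⟨a, haK, ha⟩ := hK.exists_isGreatest hKn
  obtain ⟨b, hbL, hb⟩ := hL.exists_isLeast hLn
  have disj : AEDisjoint volume ((fun x => x + -b) ⁻¹' K) ((fun x => -a + x) ⁻¹' L) := by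
    refine measure_mono_null (t := {a + b}) (fun x ⟨hx, hx'⟩ => ?_) (measure_singleton _)
    have := ha hx
    have := hb hx'
    simp only at *
    exact le_antisymm (by linarith) (by linarith)
  calc r < volume K + volume L := hst.trans (ENNReal.add_lt_add hsK htL)
    _ = volume ((fun x => x + -b) ⁻¹' K ∪ (fun x => -a + x) ⁻¹' L) := by
      rw [measure_union₀ (measurable_const_add _ hL.measurableSet).nullMeasurableSet disj,
        measure_preimage_add, measure_preimage_add_right]
    _ ≤ volume C := by
      refine measure_mono (Set.union_subset (fun x hx => ?_) fun x hx => ?_)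
      · simpa using h _ (hKA hx) b (hLB hbL)
      · simpa using h a (hKA haK) _ (hLB hx)

lemma ENNReal.rpow_mul_rpow_le_add {l : ℝ} (hl : 0 < l) (hl' : l < 1) (a b : ENNReal) :
    a ^ l * b ^ (1 - l) ≤ ENNReal.ofReal l * a + ENNReal.ofReal (1 - l) * b := by
  have h1 : 0 < 1 - l := by linarith
  rcases eq_or_ne a ⊤ with rfl | ha
  · simp [ENNReal.mul_top, hl]
  rcases eq_or_ne b ⊤ with rfl | hb
  · simp [ENNReal.mul_top, hl']
  lift a to NNReal using ha
  lift b to NNReal using hb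
  have := NNReal.geom_mean_le_arith_mean2_weighted l.toNNReal (1 - l).toNNReal a b
    (by rw [← Real.toNNReal_add hl.le h1.le]; simp)
  rw [Real.coe_toNNReal _ hl.le, Real.coe_toNNReal _ h1.le] at this
  rw [← ENNReal.coe_rpow_of_nonneg _ hl.le, ← ENNReal.coe_rpow_of_nonneg _ h1.le]
  simp only [ENNReal.ofReal]
  exact_mod_cast this

/-- One-dimensional Prékopa–Leindler inequality in its additive form, for functions
with supremum one. -/
lemma add_lintegral_le_of_iSup_eq_one {f g h : ℝ → ℝ} {l : ℝ} (hl : 0 < l) (hl' : l < 1)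
    (hf : Measurable f) (hg : Measurable g) (hh : Measurable h)
    (hf0 : ∀ x, 0 ≤ f x) (hg0 : ∀ x, 0 ≤ g x) (hh0 : ∀ x, 0 ≤ h x)
    (hf1 : ∀ x, f x ≤ 1) (hg1 : ∀ x, g x ≤ 1)
    (hf2 : ∀ t < 1, ∃ x, t < f x) (hg2 : ∀ t < 1, ∃ x, t < g x)
    (H : ∀ x y, f x ^ l * g y ^ (1 - l) ≤ h (l * x + (1 - l) * y)) :
    ENNReal.ofReal l * (∫⁻ x, ENNReal.ofReal (f x)) +
      ENNReal.ofReal (1 - l) * (∫⁻ x, ENNReal.ofReal (g x)) ≤ ∫⁻ x, ENNReal.ofReal (h x) := by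
  have h1 : 0 < 1 - l := by linarith
  rw [lintegral_eq_lintegral_meas_lt _ (.of_forall hf0) hf.aemeasurable,
    lintegral_eq_lintegral_meas_lt _ (.of_forall hg0) hg.aemeasurable,
    lintegral_eq_lintegral_meas_lt _ (.of_forall hh0) hh.aemeasurable]
  have anti (k : ℝ → ℝ) : Measurable fun t => volume {x | t < k x} :=
    Antitone.measurable fun s t hst => measure_mono fun x (hx : t < k x) => hst.trans_lt hx
  rw [← lintegral_const_mul _ (anti f), ← lintegral_const_mul _ (anti g),
    ← lintegral_add_left ((anti f).const_mul _)]
  refine setLIntegral_mono (anti h) fun t ht => ?_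
  have ht : 0 < t := ht
  rcases le_or_gt 1 t with ht1 | ht1
  · have e1 : {x | t < f x} = ∅ := by ext x; simpa using (hf1 x).trans ht1
    have e2 : {x | t < g x} = ∅ := by ext x; simpa using (hg1 x).trans ht1
    simp [e1, e2]
  have scale (c : ℝ) (hc : 0 < c) (S : Set ℝ) :
      ENNReal.ofReal c * volume S = volume ((fun x => c⁻¹ * x) ⁻¹' S) := by
    rw [Real.volume_preimage_mul_left (inv_ne_zero hc.ne'), inv_inv, abs_of_pos hc]
  rw [scale l hl, scale (1 - l) h1]
  refine volume_add_le_of_add_mem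
    ((measurable_const_mul _) (measurableSet_lt measurable_const hf))
    ((measurable_const_mul _) (measurableSet_lt measurable_const hg)) ?_ ?_ ?_
  · obtain ⟨x, hx⟩ := hf2 t ht1
    exact ⟨l * x, by simpa [hl.ne'] using hx⟩
  · obtain ⟨x, hx⟩ := hg2 t ht1
    exact ⟨(1 - l) * x, by simpa [h1.ne'] using hx⟩
  · intro a ha b hb
    have ha : t < f (l⁻¹ * a) := ha
    have hb : t < g ((1 - l)⁻¹ * b) := hb
    have := H (l⁻¹ * a) ((1 - l)⁻¹ * b)
    rw [mul_inv_cancel_left₀ hl.ne', mul_inv_cancel_left₀ h1.ne'] at this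
    refine lt_of_lt_of_le ?_ this
    calc t = t ^ l * t ^ (1 - l) := by rw [← Real.rpow_add ht]; simp
      _ < _ := mul_lt_mul'' (Real.rpow_lt_rpow ht.le ha hl) (Real.rpow_lt_rpow ht.le hb h1)
        (by positivity) (by positivity)

/-- One-dimensional Prékopa–Leindler inequality for bounded functions. -/
lemma prekopa_leindler_real {f g h : ℝ → ℝ} {l : ℝ} (hl : 0 < l) (hl' : l < 1)
    (hf : Measurable f) (hg : Measurable g) (hh : Measurable h)
    (hf0 : ∀ x, 0 ≤ f x) (hg0 : ∀ x, 0 ≤ g x) (hh0 : ∀ x, 0 ≤ h x)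
    (hfb : BddAbove (Set.range f)) (hgb : BddAbove (Set.range g))
    (H : ∀ x y, f x ^ l * g y ^ (1 - l) ≤ h (l * x + (1 - l) * y)) :
    (∫⁻ x, ENNReal.ofReal (f x)) ^ l * (∫⁻ x, ENNReal.ofReal (g x)) ^ (1 - l)
      ≤ ∫⁻ x, ENNReal.ofReal (h x) := by
  have h1 : 0 < 1 - l := by linarith
  by_cases zf : ∀ x, f x = 0
  · simp [zf, hl]
  by_cases zg : ∀ x, g x = 0
  · simp [zg, h1]
  push Not at zf zg
  obtain ⟨x₀, hx₀⟩ := zf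
  obtain ⟨y₀, hy₀⟩ := zg
  set a := ⨆ x, f x with ha
  set b := ⨆ x, g x with hb
  have a0 : 0 < a := ((hf0 x₀).lt_of_ne' hx₀).trans_le (le_ciSup hfb x₀)
  have b0 : 0 < b := ((hg0 y₀).lt_of_ne' hy₀).trans_le (le_ciSup hgb y₀)
  set c := a ^ l * b ^ (1 - l) with hc
  have c0 : 0 < c := by positivity
  have key := add_lintegral_le_of_iSup_eq_one (f := fun x => f x / a) (g := fun x => g x / b)
    (h := fun x => h x / c) hl hl' (hf.div_const _) (hg.div_const _) (hh.div_const _)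
    (fun x => div_nonneg (hf0 x) a0.le) (fun x => div_nonneg (hg0 x) b0.le)
    (fun x => div_nonneg (hh0 x) c0.le)
    (fun x => (div_le_one a0).2 (le_ciSup hfb x)) (fun x => (div_le_one b0).2 (le_ciSup hgb x))
    (fun t ht => by
      obtain ⟨x, hx⟩ := exists_lt_of_lt_ciSup (show t * a < ⨆ x, f x by rw [← ha]; nlinarith)
      exact ⟨x, (lt_div_iff₀ a0).2 hx⟩)
    (fun t ht => by
      obtain ⟨x, hx⟩ := exists_lt_of_lt_ciSup (show t * b < ⨆ x, g x by rw [← hb]; nlinarith)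
      exact ⟨x, (lt_div_iff₀ b0).2 hx⟩)
    (fun x y => by
      rw [Real.div_rpow (hf0 x) a0.le, Real.div_rpow (hg0 y) b0.le, div_mul_div_comm, ← hc]
      exact div_le_div_of_nonneg_right (H x y) c0.le)
  have key := (ENNReal.rpow_mul_rpow_le_add hl hl' _ _).trans key
  have unscale (k : ℝ → ℝ) (hk : Measurable k) (d : ℝ) (hd : 0 < d) :
      ∫⁻ x, ENNReal.ofReal (k x) = ENNReal.ofReal d * ∫⁻ x, ENNReal.ofReal (k x / d) := by
    rw [← lintegral_const_mul _ (hk.div_const d).ennreal_ofReal]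
    refine lintegral_congr fun x => ?_
    rw [← ENNReal.ofReal_mul hd.le, mul_div_cancel₀ _ hd.ne']
  rw [unscale f hf a a0, unscale g hg b b0, unscale h hh c c0,
    ENNReal.mul_rpow_of_nonneg _ _ hl.le, ENNReal.mul_rpow_of_nonneg _ _ h1.le,
    mul_mul_mul_comm, ENNReal.ofReal_rpow_of_pos a0, ENNReal.ofReal_rpow_of_pos b0,
    ← ENNReal.ofReal_mul (by positivity)]
  gcongr

lemma gaussianPDFReal_rpow_mul_rpow_le {l : ℝ} (hl : 0 < l) (hl' : l < 1) (x y : ℝ) :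
    gaussianPDFReal 0 1 x ^ l * gaussianPDFReal 0 1 y ^ (1 - l)
      ≤ gaussianPDFReal 0 1 (l * x + (1 - l) * y) := by
  have h2 : (0 : ℝ) < (√(2 * Real.pi * (1 : NNReal)))⁻¹ := by positivity
  simp only [gaussianPDFReal]
  rw [Real.mul_rpow h2.le (Real.exp_pos _).le, Real.mul_rpow h2.le (Real.exp_pos _).le,
    mul_mul_mul_comm, ← Real.rpow_add h2, ← Real.exp_mul, ← Real.exp_mul, ← Real.exp_add]
  simp only [add_sub_cancel, Real.rpow_one]
  gcongr
  simp only [NNReal.coe_one, sub_zero, mul_one]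
  nlinarith [mul_nonneg (mul_nonneg hl.le (sub_nonneg.2 hl'.le)) (sq_nonneg (x - y))]

/-- Prékopa–Leindler inequality for the standard Gaussian measure on the line. -/
lemma prekopa_leindler_gaussianReal {f g h : ℝ → ℝ} {l : ℝ} (hl : 0 < l) (hl' : l < 1)
    (hf : Measurable f) (hg : Measurable g) (hh : Measurable h)
    (hf0 : ∀ x, 0 ≤ f x) (hg0 : ∀ x, 0 ≤ g x) (hh0 : ∀ x, 0 ≤ h x)
    (hf1 : ∀ x, f x ≤ 1) (hg1 : ∀ x, g x ≤ 1)
    (H : ∀ x y, f x ^ l * g y ^ (1 - l) ≤ h (l * x + (1 - l) * y)) :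
    (∫⁻ x, ENNReal.ofReal (f x) ∂gaussianReal 0 1) ^ l *
        (∫⁻ x, ENNReal.ofReal (g x) ∂gaussianReal 0 1) ^ (1 - l)
      ≤ ∫⁻ x, ENNReal.ofReal (h x) ∂gaussianReal 0 1 := by
  have density (k : ℝ → ℝ) (hk : Measurable k) :
      ∫⁻ x, ENNReal.ofReal (k x) ∂gaussianReal 0 1
        = ∫⁻ x, ENNReal.ofReal (gaussianPDFReal 0 1 x * k x) := by
    rw [gaussianReal_of_var_ne_zero _ one_ne_zero,
      lintegral_withDensity_eq_lintegral_mul _ (measurable_gaussianPDF _ _) hk.ennreal_ofReal]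
    refine lintegral_congr fun x => ?_
    simp [gaussianPDF, ENNReal.ofReal_mul (gaussianPDFReal_nonneg 0 1 x)]
  have pdf_le (x : ℝ) : gaussianPDFReal 0 1 x ≤ (√(2 * Real.pi * (1 : NNReal)))⁻¹ := by
    refine mul_le_of_le_one_right (by positivity) (Real.exp_le_one_iff.2 ?_)
    exact div_nonpos_of_nonpos_of_nonneg (neg_nonpos.2 (sq_nonneg _)) (by positivity)
  have bdd (k : ℝ → ℝ) (hk : ∀ x, k x ≤ 1) :
      BddAbove (Set.range fun x => gaussianPDFReal 0 1 x * k x) := by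
    refine ⟨(√(2 * Real.pi * (1 : NNReal)))⁻¹, Set.forall_mem_range.2 fun x => ?_⟩
    exact (mul_le_of_le_one_right (gaussianPDFReal_nonneg 0 1 x) (hk x)).trans (pdf_le x)
  have p0 := gaussianPDFReal_nonneg 0 1
  have pm := measurable_gaussianPDFReal 0 1
  rw [density f hf, density g hg, density h hh]
  refine prekopa_leindler_real hl hl' (pm.mul hf) (pm.mul hg) (pm.mul hh)
    (fun x => mul_nonneg (p0 x) (hf0 x)) (fun x => mul_nonneg (p0 x) (hg0 x))
    (fun x => mul_nonneg (p0 x) (hh0 x)) (bdd f hf1) (bdd g hg1) fun x y => ?_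
  rw [Real.mul_rpow (p0 x) (hf0 x), Real.mul_rpow (p0 y) (hg0 y), mul_mul_mul_comm]
  exact mul_le_mul (gaussianPDFReal_rpow_mul_rpow_le hl hl' x y) (H x y)
    (mul_nonneg (Real.rpow_nonneg (hf0 x) _) (Real.rpow_nonneg (hg0 y) _)) (p0 _)

/-- Log-concavity of the standard Gaussian measure on the line. -/
lemma gaussianReal_log_concave {A B C : Set ℝ} {l : ℝ} (hl : 0 < l) (hl' : l < 1)
    (hA : MeasurableSet A) (hB : MeasurableSet B) (hC : MeasurableSet C)
    (h : ∀ a ∈ A, ∀ b ∈ B, l * a + (1 - l) * b ∈ C) :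
    gaussianReal 0 1 A ^ l * gaussianReal 0 1 B ^ (1 - l) ≤ gaussianReal 0 1 C := by
  have h1 : 0 < 1 - l := by linarith
  have ind (S : Set ℝ) (hS : MeasurableSet S) :
      gaussianReal 0 1 S
        = ∫⁻ x, ENNReal.ofReal (S.indicator (fun _ => (1 : ℝ)) x) ∂gaussianReal 0 1 := by
    rw [← lintegral_indicator_one hS]
    refine lintegral_congr fun x => ?_
    by_cases hx : x ∈ S <;> simp [hx]
  have nonneg (S : Set ℝ) (x : ℝ) : 0 ≤ S.indicator (fun _ => (1 : ℝ)) x :=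
    Set.indicator_nonneg (fun _ _ => zero_le_one) x
  have le_one (S : Set ℝ) (x : ℝ) : S.indicator (fun _ => (1 : ℝ)) x ≤ 1 :=
    Set.indicator_le_self' (fun _ _ => zero_le_one) x
  rw [ind A hA, ind B hB, ind C hC]
  refine prekopa_leindler_gaussianReal hl hl' (measurable_const.indicator hA)
    (measurable_const.indicator hB) (measurable_const.indicator hC)
    (nonneg A) (nonneg B) (nonneg C) (le_one A) (le_one B) fun x y => ?_
  by_cases hx : x ∈ A
  · by_cases hy : y ∈ B
    · simp [hx, hy, h x hx y hy]
    · simpa [hy, h1.ne'] using nonneg C _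
  · simpa [hx, hl.ne'] using nonneg C _

/-- Log-concavity of the standard Gaussian measure on the plane. -/
lemma gauss2_log_concave {A B C : Set (ℝ × ℝ)} {l : ℝ} (hl : 0 < l) (hl' : l < 1)
    (hA : MeasurableSet A) (hB : MeasurableSet B) (hC : MeasurableSet C)
    (h : ∀ a ∈ A, ∀ b ∈ B, (l * a.1 + (1 - l) * b.1, l * a.2 + (1 - l) * b.2) ∈ C) :
    gauss2 A ^ l * gauss2 B ^ (1 - l) ≤ gauss2 C := by
  have slice (S : Set (ℝ × ℝ)) (hS : MeasurableSet S) :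
      gauss2 S = ∫⁻ x, ENNReal.ofReal (gaussianReal 0 1 (Prod.mk x ⁻¹' S)).toReal
        ∂gaussianReal 0 1 := by
    rw [gauss2, Measure.prod_apply hS]
    exact lintegral_congr fun x => (ENNReal.ofReal_toReal (measure_ne_top _ _)).symm
  have meas (S : Set (ℝ × ℝ)) (hS : MeasurableSet S) :
      Measurable fun x => (gaussianReal 0 1 (Prod.mk x ⁻¹' S)).toReal :=
    (measurable_measure_prodMk_left hS).ennreal_toReal
  have le_one (S : Set (ℝ × ℝ)) (x : ℝ) : (gaussianReal 0 1 (Prod.mk x ⁻¹' S)).toReal ≤ 1 :=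
    measureReal_le_one
  rw [slice A hA, slice B hB, slice C hC]
  refine prekopa_leindler_gaussianReal hl hl' (meas A hA) (meas B hB) (meas C hC)
    (fun _ => ENNReal.toReal_nonneg) (fun _ => ENNReal.toReal_nonneg)
    (fun _ => ENNReal.toReal_nonneg) (le_one A) (le_one B) fun x y => ?_
  rw [ENNReal.toReal_rpow, ENNReal.toReal_rpow, ← ENNReal.toReal_mul]
  exact ENNReal.toReal_mono (measure_ne_top _ _)
    (gaussianReal_log_concave hl hl' (measurable_prodMk_left hA) (measurable_prodMk_left hB)
      (measurable_prodMk_left hC) fun a ha b hb => h _ ha _ hb)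

/-- For fixed `β ∈ [0,1]` and `γ ∈ ℝ`, the function `h` is log-concave
on `ℝ²`: `h(λ·a + (1−λ)·a') ≥ h(a)^λ · h(a')^{1−λ}`. -/
theorem cornerProb_log_concave (β γ : ℝ) (hβ : β ∈ Set.Icc (0 : ℝ) 1) :
    ∀ α₁ α₂ α₁' α₂' l : ℝ, l ∈ Set.Icc (0 : ℝ) 1 →
      cornerProb β γ α₁ α₂ ^ l * cornerProb β γ α₁' α₂' ^ (1 - l)
        ≤ cornerProb β γ (l * α₁ + (1 - l) * α₁') (l * α₂ + (1 - l) * α₂') := by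
  rintro α₁ α₂ α₁' α₂' l ⟨hl, hl'⟩
  rcases hl.eq_or_lt with rfl | hl
  · simp
  rcases hl'.eq_or_lt with rfl | hl'
  · simp
  have h1 : 0 < 1 - l := by linarith
  have : IsProbabilityMeasure gauss2 := by unfold gauss2; infer_instance
  have meas (s t u v : ℝ) :
      MeasurableSet {p : ℝ × ℝ | u ≤ s * p.1 + t * p.2 ∧ v ≤ s * p.1 - t * p.2} := by
    rw [Set.ofPred_and]
    exact (measurableSet_le (by fun_prop) (by fun_prop)).inter
      (measurableSet_le (by fun_prop) (by fun_prop))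
  unfold cornerProb
  rw [ENNReal.toReal_rpow, ENNReal.toReal_rpow, ← ENNReal.toReal_mul]
  refine ENNReal.toReal_mono (measure_ne_top _ _)
    (gauss2_log_concave hl hl' (meas _ _ _ _) (meas _ _ _ _) (meas _ _ _ _) ?_)
  rintro ⟨x, y⟩ ⟨hx, hy⟩ ⟨x', y'⟩ ⟨hx', hy'⟩
  simp only at hx hy hx' hy'
  constructor <;> simp only
  · linarith [mul_le_mul_of_nonneg_left hx hl.le, mul_le_mul_of_nonneg_left hx' h1.le]
  · linarith [mul_le_mul_of_nonneg_left hy hl.le, mul_le_mul_of_nonneg_left hy' h1.le]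
end
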